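/- arXiv:math/0608416 — 6 statements merged into one kernel-verified Lean document; each statement's English description precedes it below -/
import Mathlib

section
/- Let M be a locally complete metric space and X an arc field on M satisfying Conditions E1 and E2. Then for every point x ∈ M there exists a solution curve σ_x : (α_x,β_x) → M to X with σ_x(0) = x, and it is unique and maximal: any solution curve to X with initial condition x is the restriction of σ_x to a subinterval of (α_x,β_x). -/
open Metric Set Asymptotics

/-- A metric space is *locally complete* if every point has a complete neighborhood. -/
def LocallyComplete (M : Type*) [MetricSpace M] : Prop :=
  ∀ x : M, ∃ s ∈ nhds x, IsComplete s

variable {M : Type*} [MetricSpace M]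

/-- `X : M → ℝ → M` is an *arc field* (only the values for `t ∈ [-1,1]` are relevant):
it is continuous, `X x 0 = x`, each arc `t ↦ X x t` is Lipschitz, and the Lipschitz
constant (the speed `ρ`) is locally bounded. -/
def IsArcField (X : M → ℝ → M) : Prop :=
  ContinuousOn (fun p : M × ℝ => X p.1 p.2) (univ ×ˢ Icc (-1 : ℝ) 1) ∧
  (∀ x, X x 0 = x) ∧
  (∀ x : M, ∃ r > (0 : ℝ), ∃ K > (0 : ℝ), ∀ y ∈ ball x r, ∀ s ∈ Icc (-1 : ℝ) 1,
      ∀ t ∈ Icc (-1 : ℝ) 1, dist (X y s) (X y t) ≤ K * |s - t|)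

/-- Condition E1. -/
def CondE1 (X : M → ℝ → M) : Prop :=
  ∀ x₀ : M, ∃ r > (0 : ℝ), ∃ δ > (0 : ℝ), ∃ Λ > (0 : ℝ),
    ∀ x ∈ ball x₀ r, ∀ y ∈ ball x₀ r, ∀ t : ℝ, |t| < δ →
      dist (X x t) (X y t) ≤ dist x y * (1 + |t| * Λ)

/-- Condition E2. -/
def CondE2 (X : M → ℝ → M) : Prop :=
  ∀ x₀ : M, ∃ r > (0 : ℝ), ∃ δ > (0 : ℝ), ∃ Ω > (0 : ℝ),
    ∀ x ∈ ball x₀ r, ∀ s t : ℝ, |s| < δ → |t| < δ →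
      dist (X x (s + t)) (X (X x s) t) ≤ |s * t| * Ω

/-- Two arc fields *close*: `d(Y_s X_t x, X_t Y_s x) = O(|st|)` locally uniformly. -/
def Close (X Y : M → ℝ → M) : Prop :=
  ∀ x₀ : M, ∃ C > (0 : ℝ), ∃ r > (0 : ℝ), ∃ δ > (0 : ℝ),
    ∀ x ∈ ball x₀ r, ∀ s t : ℝ, |s| < δ → |t| < δ →
      dist (Y (X x t) s) (X (Y x s) t) ≤ C * |s * t|

/-- `σ` is a solution curve of `X` on the open interval `I` (an open order-connected
set of reals containing `0`) with initial condition `x`. -/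
structure IsSolutionCurve (X : M → ℝ → M) (I : Set ℝ) (σ : ℝ → M) (x : M) : Prop where
  isOpen : IsOpen I
  ordConnected : I.OrdConnected
  zero_mem : (0 : ℝ) ∈ I
  init : σ 0 = x
  cont : ContinuousOn σ I
  tangent : ∀ t ∈ I,
    (fun h : ℝ => dist (σ (t + h)) (X (σ t) h)) =o[nhds (0 : ℝ)] fun h => h

/-- The sum of two arc fields: `(X+Y)_t x := Y_t (X_t x)`. -/
def sumArc (X Y : M → ℝ → M) (x : M) (t : ℝ) : M := Y (X x t) t

/-- The product of a function `a : M → ℝ` with an arc field: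
`(aX)(x,t) := X(x, a(x)·t)`, the time truncated to `[-1,1]`. -/
def smulArc (a : M → ℝ) (X : M → ℝ → M) (x : M) (t : ℝ) : M :=
  X x (max (-1) (min 1 (a x * t)))

/-- The bracket of two arc fields. -/
noncomputable def bracket (X Y : M → ℝ → M) (x : M) (t : ℝ) : M :=
  if 0 ≤ t then
    Y (X (Y (X x (Real.sqrt |t|)) (Real.sqrt |t|)) (-Real.sqrt |t|)) (-Real.sqrt |t|)
  else
    X (Y (X (Y x (Real.sqrt |t|)) (Real.sqrt |t|)) (-Real.sqrt |t|)) (-Real.sqrt |t|)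

/-- Local uniform tangency `Z ∼ W` of arc fields: `d(Z_t x, W_t x) = o(t)`
locally uniformly in `x`. -/
def LocUnifTangent (Z W : M → ℝ → M) : Prop :=
  ∀ x₀ : M, ∃ r > (0 : ℝ), ∀ ε > (0 : ℝ), ∃ δ > (0 : ℝ),
    ∀ x ∈ ball x₀ r, ∀ t : ℝ, 0 < |t| → |t| < δ → dist (Z x t) (W x t) ≤ ε * |t|

/-- Transversality of two arc fields. -/
def Transverse (X Y : M → ℝ → M) : Prop :=
  ∀ x₀ : M, ∃ δ > (0 : ℝ), ∀ x ∈ ball x₀ δ, ∀ s t : ℝ, |s| < δ → |t| < δ →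
    δ * (|s| + |t|) ≤ dist (X x s) (Y x t)

/-- A set `S` is locally uniformly tangent to the arc field `Z`:
`d(Z_t x, S) = o(t)` locally uniformly for `x ∈ S`. -/
def SetTangentTo (S : Set M) (Z : M → ℝ → M) : Prop :=
  ∀ x₀ ∈ S, ∃ r > (0 : ℝ), ∀ ε > (0 : ℝ), ∃ δ > (0 : ℝ), ∀ x ∈ S ∩ ball x₀ r,
    ∀ t : ℝ, 0 < |t| → |t| < δ → Metric.infDist (Z x t) S ≤ ε * |t|

/-- `S` is an integral surface of the arc fields `X` and `Y`: a 2-dimensional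
topological manifold locally uniformly tangent to `aX + bY` for all Lipschitz `a b`. -/
def IsIntegralSurface (X Y : M → ℝ → M) (S : Set M) : Prop :=
  Nonempty (ChartedSpace (EuclideanSpace ℝ (Fin 2)) S) ∧
  ∀ a b : M → ℝ, (∃ K, LipschitzWith K a) → (∃ K, LipschitzWith K b) →
    SetTangentTo S (sumArc (smulArc a X) (smulArc b Y))

/-- The bracket of two local flows `F`, `G` (with time domains `IF x`, `IG x`)
is defined at `(x,t)` if all needed times lie in the relevant domains. -/
noncomputable def FlowBracketDefined (F G : M → ℝ → M) (IF IG : M → Set ℝ)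
    (x : M) (t : ℝ) : Prop :=
  if 0 ≤ t then
    Real.sqrt |t| ∈ IF x ∧ Real.sqrt |t| ∈ IG (F x (Real.sqrt |t|)) ∧
      (-Real.sqrt |t|) ∈ IF (G (F x (Real.sqrt |t|)) (Real.sqrt |t|)) ∧
      (-Real.sqrt |t|) ∈ IG (F (G (F x (Real.sqrt |t|)) (Real.sqrt |t|)) (-Real.sqrt |t|))
  else
    Real.sqrt |t| ∈ IG x ∧ Real.sqrt |t| ∈ IF (G x (Real.sqrt |t|)) ∧
      (-Real.sqrt |t|) ∈ IG (F (G x (Real.sqrt |t|)) (Real.sqrt |t|)) ∧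
      (-Real.sqrt |t|) ∈ IF (G (F (G x (Real.sqrt |t|)) (Real.sqrt |t|)) (-Real.sqrt |t|))

/-- Local uniform tangency of the bracket of two local flows to an arc field `W`,
required only where the bracket is defined. -/
noncomputable def FlowBracketTangent (F G : M → ℝ → M) (IF IG : M → Set ℝ)
    (W : M → ℝ → M) : Prop :=
  ∀ x₀ : M, ∃ r > (0 : ℝ), ∀ ε > (0 : ℝ), ∃ δ > (0 : ℝ), ∀ x ∈ ball x₀ r, ∀ t : ℝ,
    0 < |t| → |t| < δ → FlowBracketDefined F G IF IG x t →
      dist (bracket F G x t) (W x t) ≤ ε * |t|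

/-- Linear speed growth of an arc field. -/
def LinearSpeedGrowth (X : M → ℝ → M) : Prop :=
  ∃ x : M, ∃ c₁ > (0 : ℝ), ∃ c₂ > (0 : ℝ), ∀ r > (0 : ℝ), ∀ y ∈ ball x r,
    ∀ s ∈ Icc (-1 : ℝ) 1, ∀ t ∈ Icc (-1 : ℝ) 1,
      dist (X y s) (X y t) ≤ (c₁ * r + c₂) * |s - t|

/-- Iterated sum of a list of arc fields. -/
def comboList : List (M → ℝ → M) → M → ℝ → M
  | [], x, _ => x
  | Z :: L, x, t => comboList L (Z x t) t

/-- The linear combination `a₁X¹ + ⋯ + aₙXⁿ` of arc fields. -/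
def combo {n : ℕ} (X : Fin n → M → ℝ → M) (a : Fin n → M → ℝ) : M → ℝ → M :=
  comboList (List.ofFn fun i => smulArc (a i) (X i))

/-- The distance from `y` to the set of curves through `x` of the linear span
distribution `Δ(X¹,…,Xⁿ)`. -/
noncomputable def distToSpan {n : ℕ} (X : Fin n → M → ℝ → M) (y x : M) : ℝ :=
  sInf {r : ℝ | ∃ (a : Fin n → ℝ) (s : ℝ), s ∈ Icc (-1 : ℝ) 1 ∧
    r = dist y (combo X (fun i _ => a i) x s)}

/-- Local uniform tangency of an arc field to the distribution `Δ(X¹,…,Xⁿ)`. -/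
noncomputable def TangentToSpan {n : ℕ} (Z : M → ℝ → M) (X : Fin n → M → ℝ → M) : Prop :=
  ∀ x₀ : M, ∃ r > (0 : ℝ), ∀ ε > (0 : ℝ), ∃ δ > (0 : ℝ), ∀ x ∈ ball x₀ r, ∀ t : ℝ,
    0 < |t| → |t| < δ → distToSpan X (Z x t) x ≤ ε * |t|

/-- The family `X¹,…,Xⁿ` is transverse: each `Xⁱ` is transverse to the linear span
of the remaining arc fields (encoded by coefficient functions vanishing at slot `i`). -/
def TransverseFamily {n : ℕ} (X : Fin n → M → ℝ → M) : Prop :=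
  ∀ i : Fin n, ∀ x₀ : M, ∃ δ > (0 : ℝ), ∀ x ∈ ball x₀ δ, ∀ a : Fin n → ℝ, a i = 0 →
    ∀ s t : ℝ, |s| < δ → |t| < δ →
      δ * (|s| + |t|) ≤ dist (X i x t) (combo X (fun j _ => a j) x s)

/-- Involutivity of the distribution `Δ(X¹,…,Xⁿ)`. -/
noncomputable def InvolutiveFamily {n : ℕ} (X : Fin n → M → ℝ → M) : Prop :=
  ∀ i j : Fin n, TangentToSpan (bracket (X i) (X j)) X

/-- `S` is an integral surface for the distribution `Δ(X¹,…,Xⁿ)`. -/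
def IsIntegralSurfaceFamily {n : ℕ} (X : Fin n → M → ℝ → M) (S : Set M) : Prop :=
  Nonempty (ChartedSpace (EuclideanSpace ℝ (Fin n)) S) ∧
  ∀ a : Fin n → M → ℝ, (∀ i, ∃ K, LipschitzWith K (a i)) →
    SetTangentTo S (combo X a)

open Filter Topology

/-- Bounds for an arc field `X`, uniform over a ball about `x₀` contained in a complete set
and over times at most `T` in absolute value; the last condition says that arcs starting near
`x₀` do not leave the ball before time `T`. -/
structure UniformArcBounds (X : M → ℝ → M) (x₀ : M) (r T K Λ Ω : ℝ) : Prop where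
  T_pos : 0 < T
  K_pos : 0 < K
  Λ_pos : 0 < Λ
  Ω_pos : 0 < Ω
  complete : ∃ s, IsComplete s ∧ ball x₀ r ⊆ s
  zero : ∀ x, X x 0 = x
  speed : ∀ y ∈ ball x₀ r, ∀ s t : ℝ, |s| ≤ T → |t| ≤ T → dist (X y s) (X y t) ≤ K * |s - t|
  e1 : ∀ x ∈ ball x₀ r, ∀ y ∈ ball x₀ r, ∀ t : ℝ, |t| ≤ T →
    dist (X x t) (X y t) ≤ dist x y * (1 + |t| * Λ)
  e2 : ∀ x ∈ ball x₀ r, ∀ s t : ℝ, |s| ≤ T → |t| ≤ T →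
    dist (X x (s + t)) (X (X x s) t) ≤ |s * t| * Ω
  escape : 2 * (K * T) < r

theorem exists_uniformArcBounds (hM : LocallyComplete M) {X : M → ℝ → M} (hX : IsArcField X)
    (hE1 : CondE1 X) (hE2 : CondE2 X) (x₀ : M) :
    ∃ r T K Λ Ω, UniformArcBounds X x₀ r T K Λ Ω := by
  obtain ⟨s, hs, hsc⟩ := hM x₀
  obtain ⟨r₀, hr₀, hball⟩ := Metric.mem_nhds_iff.1 hs
  obtain ⟨r₁, hr₁, K, hK, hspeed⟩ := hX.2.2 x₀
  obtain ⟨r₂, hr₂, δ₂, hδ₂, Λ, hΛ, h1⟩ := hE1 x₀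
  obtain ⟨r₃, hr₃, δ₃, hδ₃, Ω, hΩ, h2⟩ := hE2 x₀
  obtain ⟨r, hr, hrlt⟩ : ∃ r > 0, r ≤ r₀ ∧ r ≤ r₁ ∧ r ≤ r₂ ∧ r ≤ r₃ :=
    ⟨min (min r₀ r₁) (min r₂ r₃), by positivity, by simp, by simp, by simp, by simp⟩
  obtain ⟨T, hT, hT1, hT2, hT3, hT4⟩ :
      ∃ T > 0, T ≤ 1 ∧ T ≤ δ₂ / 2 ∧ T ≤ δ₃ / 2 ∧ T ≤ r / (4 * K) :=
    ⟨min (min 1 (δ₂ / 2)) (min (δ₃ / 2) (r / (4 * K))), by positivity, by simp, by simp,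
      by simp, by simp⟩
  refine ⟨r, T, K, Λ, Ω, hT, hK, hΛ, hΩ, ⟨s, hsc, (ball_subset_ball hrlt.1).trans hball⟩,
    hX.2.1, ?_, ?_, ?_, ?_⟩
  · intro y hy s t hs ht
    exact hspeed y (ball_subset_ball hrlt.2.1 hy) s (abs_le.1 (hs.trans hT1)) t
      (abs_le.1 (ht.trans hT1))
  · intro x hx y hy t ht
    exact h1 x (ball_subset_ball hrlt.2.2.1 hx) y (ball_subset_ball hrlt.2.2.1 hy) t (by linarith)
  · intro x hx s t hs ht
    exact h2 x (ball_subset_ball hrlt.2.2.2 hx) s t (by linarith) (by linarith)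
  · rw [le_div_iff₀ (by positivity)] at hT4
    nlinarith

namespace UniformArcBounds

variable {X : M → ℝ → M} {x₀ : M} {r T K Λ Ω : ℝ}

theorem reverse (b : UniformArcBounds X x₀ r T K Λ Ω) :
    UniformArcBounds (fun x t => X x (-t)) x₀ r T K Λ Ω where
  T_pos := b.T_pos
  K_pos := b.K_pos
  Λ_pos := b.Λ_pos
  Ω_pos := b.Ω_pos
  complete := b.complete
  zero x := by simp [b.zero]
  speed y hy s t hs ht := by
    have := b.speed y hy (-s) (-t) (by simpa) (by simpa)
    rwa [neg_sub_neg, abs_sub_comm] at this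
  e1 x hx y hy t ht := by simpa using b.e1 x hx y hy (-t) (by simpa)
  e2 x hx s t hs ht := by
    simpa [add_comm] using b.e2 x hx (-s) (-t) (by simpa) (by simpa)
  escape := b.escape

theorem dist_arc_le (b : UniformArcBounds X x₀ r T K Λ Ω) {y : M} (hy : y ∈ ball x₀ r)
    {t : ℝ} (ht : |t| ≤ T) : dist (X y t) y ≤ K * |t| := by
  have := b.speed y hy t 0 ht (by simpa using b.T_pos.le)
  rwa [b.zero, sub_zero] at this

theorem arc_mem_ball (b : UniformArcBounds X x₀ r T K Λ Ω) {y : M} (hy : dist y x₀ ≤ K * T)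
    {t : ℝ} (ht : |t| ≤ T) : X y t ∈ ball x₀ r := by
  have hK := b.K_pos
  have hT := b.T_pos
  have hesc := b.escape
  have hpos : 0 < K * T := by positivity
  have h1 := b.dist_arc_le (y := y) (by rw [mem_ball]; linarith) ht
  have h2 := dist_triangle (X y t) y x₀
  have h3 : K * |t| ≤ K * T := by gcongr
  rw [mem_ball]
  linarith

theorem mem_ball_of_dist_le (b : UniformArcBounds X x₀ r T K Λ Ω) {y : M}
    (hy : dist y x₀ ≤ K * T) : y ∈ ball x₀ r := by
  have := b.arc_mem_ball hy (t := 0) (by simpa using b.T_pos.le)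
  rwa [b.zero] at this

theorem dist_iterate_le (b : UniformArcBounds X x₀ r T K Λ Ω) {y : M} {h : ℝ} (hh : 0 ≤ h) (k : ℕ)
    (hk : k * h ≤ T) (hy : dist y x₀ + K * (k * h) < r) :
    dist ((fun z => X z h)^[k] y) y ≤ K * (k * h) := by
  have hK := b.K_pos
  induction k with
  | zero => simp
  | succ k ih =>
    push_cast at hk hy ⊢
    have hkh : 0 ≤ (k : ℝ) * h := by positivity
    have ih := ih (by linarith) (by nlinarith)
    rw [Function.iterate_succ_apply']
    set z := (fun z => X z h)^[k] y
    have hz : z ∈ ball x₀ r := by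
      rw [mem_ball]
      nlinarith [dist_triangle z y x₀]
    have h1 := b.dist_arc_le hz (t := h) (by rw [abs_of_nonneg hh]; linarith)
    rw [abs_of_nonneg hh] at h1
    nlinarith [dist_triangle (X z h) z y]

theorem dist_iterate_arc_le (b : UniformArcBounds X x₀ r T K Λ Ω) {y : M} {h : ℝ} (hh : 0 ≤ h)
    (k : ℕ) (hk : k * h ≤ T) (hy : dist y x₀ ≤ K * T) :
    dist ((fun z => X z h)^[k] y) (X y (k * h)) ≤ (1 + h * Λ) ^ k * (Ω * (k * h) ^ 2) := by
  have hK := b.K_pos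
  have hΛ := b.Λ_pos
  have hΩ := b.Ω_pos
  have hesc := b.escape
  induction k with
  | zero => simp [b.zero]
  | succ k ih =>
    push_cast at hk ⊢
    have hkh : 0 ≤ (k : ℝ) * h := by positivity
    have hkT : (k : ℝ) * h ≤ T := by linarith
    have ih := ih hkT
    have hmem : (fun z => X z h)^[k] y ∈ ball x₀ r := by
      have h1 := b.dist_iterate_le (y := y) hh k hkT (by nlinarith)
      rw [mem_ball]
      nlinarith [dist_triangle ((fun z => X z h)^[k] y) y x₀]
    have hmem' : X y (k * h) ∈ ball x₀ r := b.arc_mem_ball hy (by rwa [abs_of_nonneg hkh])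
    rw [Function.iterate_succ_apply']
    set z := (fun z => X z h)^[k] y
    have hhT : |h| ≤ T := by rw [abs_of_nonneg hh]; linarith
    have h1 := b.e1 z hmem _ hmem' h hhT
    have h2 := b.e2 y (b.mem_ball_of_dist_le hy) (k * h) h (by rwa [abs_of_nonneg hkh]) hhT
    rw [abs_of_nonneg (by positivity)] at h1 h2
    rw [dist_comm] at h2
    have h3 := dist_triangle (X z h) (X (X y (k * h)) h) (X y (k * h + h))
    have h4 : dist z (X y (k * h)) * (1 + h * Λ) ≤
        (1 + h * Λ) ^ k * (Ω * (k * h) ^ 2) * (1 + h * Λ) := by gcongr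
    have h5 : 1 * (k * h * h * Ω) ≤ (1 + h * Λ) ^ (k + 1) * ((2 * k + 1) * h * h * Ω) := by
      gcongr
      · exact one_le_pow₀ (by nlinarith)
      · linarith [(Nat.cast_nonneg k : (0 : ℝ) ≤ k)]
    rw [add_mul, one_mul]
    calc _ ≤ _ := h3
      _ ≤ (1 + h * Λ) ^ k * (Ω * (k * h) ^ 2) * (1 + h * Λ) +
          (1 + h * Λ) ^ (k + 1) * ((2 * k + 1) * h * h * Ω) := by linarith
      _ = _ := by ring

theorem dist_iterate_half_le (b : UniformArcBounds X x₀ r T K Λ Ω) {h : ℝ} (hh : 0 ≤ h)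
    (k : ℕ) (hk : k * h ≤ T) :
    dist ((fun z => X z h)^[k] x₀) ((fun z => X z (h / 2))^[2 * k] x₀) ≤
      (1 + h * Λ) ^ k * (Ω * h ^ 2 * k) := by
  have hK := b.K_pos
  have hΛ := b.Λ_pos
  have hΩ := b.Ω_pos
  have hT := b.T_pos
  have hesc := b.escape
  induction k with
  | zero => simp
  | succ k ih =>
    push_cast at hk ⊢
    have hkh : 0 ≤ (k : ℝ) * h := by positivity
    have hkT : (k : ℝ) * h ≤ T := by linarith
    have ih := ih hkT
    have hKT : 0 < K * T := by positivity
    have hmem : (fun z => X z h)^[k] x₀ ∈ ball x₀ r := by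
      have h1 := b.dist_iterate_le (y := x₀) hh k hkT (by simp; nlinarith)
      rw [mem_ball]
      nlinarith
    have hmem' : (fun z => X z (h / 2))^[2 * k] x₀ ∈ ball x₀ r := by
      have h0 : ((2 * k : ℕ) : ℝ) * (h / 2) = k * h := by push_cast; ring
      have h1 := b.dist_iterate_le (y := x₀) (h := h / 2) (by positivity) (2 * k)
        (by rwa [h0]) (by rw [h0]; simp; nlinarith)
      rw [h0] at h1
      rw [mem_ball]
      nlinarith
    rw [show 2 * (k + 1) = 2 * k + 1 + 1 by ring, Function.iterate_succ_apply',
      Function.iterate_succ_apply', Function.iterate_succ_apply']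
    set z := (fun z => X z h)^[k] x₀
    set w := (fun z => X z (h / 2))^[2 * k] x₀
    have hh2 : 0 ≤ h / 2 := by positivity
    have hhT : |h| ≤ T := by rw [abs_of_nonneg hh]; linarith
    have hhT2 : |h / 2| ≤ T := by rw [abs_of_nonneg hh2]; linarith
    have h1 := b.e1 z hmem w hmem' h hhT
    have h2 := b.e2 w hmem' (h / 2) (h / 2) hhT2 hhT2
    rw [abs_of_nonneg (by positivity)] at h1 h2
    rw [add_halves] at h2
    have h3 := dist_triangle (X z h) (X w h) (X (X w (h / 2)) (h / 2))
    have h4 : dist z w * (1 + h * Λ) ≤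
        (1 + h * Λ) ^ k * (Ω * h ^ 2 * k) * (1 + h * Λ) := by gcongr
    have h5 : 1 * (Ω * h ^ 2) ≤ (1 + h * Λ) ^ (k + 1) * (Ω * h ^ 2) := by
      gcongr
      exact one_le_pow₀ (by nlinarith)
    have h6 : h / 2 * (h / 2) * Ω ≤ Ω * h ^ 2 := by nlinarith [mul_nonneg hΩ.le (sq_nonneg h)]
    calc _ ≤ _ := h3
      _ ≤ (1 + h * Λ) ^ k * (Ω * h ^ 2 * k) * (1 + h * Λ) +
          (1 + h * Λ) ^ (k + 1) * (Ω * h ^ 2) := by linarith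
      _ = _ := by ring

theorem one_add_pow_le (b : UniformArcBounds X x₀ r T K Λ Ω) {h : ℝ} (hh : 0 ≤ h)
    (k : ℕ) (hk : k * h ≤ T) : (1 + h * Λ) ^ k ≤ Real.exp (T * Λ) := by
  have hΛ := b.Λ_pos
  calc (1 + h * Λ) ^ k ≤ Real.exp (h * Λ) ^ k := by
        gcongr
        linarith [Real.add_one_le_exp (h * Λ)]
    _ = Real.exp (k * h * Λ) := by rw [← Real.exp_nat_mul]; ring_nf
    _ ≤ _ := by gcongr

/-- The Euler polygon from `x` with dyadic step `2⁻ⁿ`, evaluated at the last node before `t`. -/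
noncomputable def euler (X : M → ℝ → M) (x : M) (n : ℕ) (t : ℝ) : M :=
  (fun z => X z ((1 / 2) ^ n))^[⌊t * 2 ^ n⌋₊] x

theorem floor_mul_pow_le {t : ℝ} (ht : 0 ≤ t) (n : ℕ) :
    (⌊t * 2 ^ n⌋₊ : ℝ) * (1 / 2) ^ n ≤ t := by
  calc (⌊t * 2 ^ n⌋₊ : ℝ) * (1 / 2) ^ n ≤ t * 2 ^ n * (1 / 2) ^ n := by
        gcongr
        exact Nat.floor_le (by positivity)
    _ = t := by rw [mul_assoc, ← mul_pow]; norm_num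

theorem tendsto_floor_mul_pow {t : ℝ} (ht : 0 ≤ t) :
    Tendsto (fun n : ℕ => (⌊t * 2 ^ n⌋₊ : ℝ) * (1 / 2) ^ n) atTop (𝓝 t) := by
  have h1 := (tendsto_nat_floor_mul_div_atTop ht).comp
    (tendsto_pow_atTop_atTop_of_one_lt (one_lt_two : (1 : ℝ) < 2))
  refine h1.congr fun n => ?_
  simp [div_eq_mul_inv]

theorem dist_euler_le (b : UniformArcBounds X x₀ r T K Λ Ω) {t : ℝ} (ht : 0 ≤ t) (htT : t ≤ T)
    (n : ℕ) : dist (euler X x₀ n t) x₀ ≤ K * T := by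
  have hK := b.K_pos
  have hT := b.T_pos
  have hesc := b.escape
  have h1 := floor_mul_pow_le ht n
  have h2 : K * (⌊t * 2 ^ n⌋₊ * (1 / 2) ^ n) ≤ K * T := by gcongr; linarith
  refine (b.dist_iterate_le (by positivity) _ (h1.trans htT) ?_).trans h2
  rw [dist_self]
  nlinarith [mul_pos hK hT]

theorem dist_euler_succ_le (b : UniformArcBounds X x₀ r T K Λ Ω) {t : ℝ} (ht : 0 ≤ t)
    (htT : t ≤ T) (n : ℕ) :
    dist (euler X x₀ n t) (euler X x₀ (n + 1) t) ≤
      (Real.exp (T * Λ) * (Ω * T) + K) * (1 / 2) ^ n := by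
  have hK := b.K_pos
  have hT := b.T_pos
  have hΩ := b.Ω_pos
  have hesc := b.escape
  have hKT := mul_pos hK hT
  have hq := floor_mul_pow_le ht n
  have hp := floor_mul_pow_le ht (n + 1)
  have hcases : ⌊t * 2 ^ (n + 1)⌋₊ = 2 * ⌊t * 2 ^ n⌋₊ ∨
      ⌊t * 2 ^ (n + 1)⌋₊ = 2 * ⌊t * 2 ^ n⌋₊ + 1 := by
    have h1 := Nat.floor_le (show 0 ≤ t * 2 ^ n by positivity)
    have h2 := Nat.lt_floor_add_one (t * 2 ^ n)
    have h3 : 2 * ⌊t * 2 ^ n⌋₊ ≤ ⌊t * 2 ^ (n + 1)⌋₊ :=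
      Nat.le_floor (by push_cast; rw [pow_succ]; linarith)
    have h4 : ⌊t * 2 ^ (n + 1)⌋₊ < 2 * ⌊t * 2 ^ n⌋₊ + 2 :=
      (Nat.floor_lt (by positivity)).2 (by push_cast; rw [pow_succ]; linarith)
    omega
  have hhalf : ((1 : ℝ) / 2) ^ (n + 1) = (1 / 2) ^ n / 2 := by rw [pow_succ]; ring
  unfold euler
  set q := ⌊t * 2 ^ n⌋₊
  set h : ℝ := (1 / 2) ^ n
  have hh : 0 < h := by positivity
  have hfirst : dist ((fun z => X z h)^[q] x₀) ((fun z => X z (h / 2))^[2 * q] x₀) ≤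
      Real.exp (T * Λ) * (Ω * T) * h := by
    refine (b.dist_iterate_half_le hh.le q (by linarith)).trans ?_
    calc (1 + h * Λ) ^ q * (Ω * h ^ 2 * q) ≤ Real.exp (T * Λ) * (Ω * h ^ 2 * q) := by
          gcongr
          exact b.one_add_pow_le hh.le q (by linarith)
      _ = Real.exp (T * Λ) * (Ω * (q * h)) * h := by ring
      _ ≤ _ := by gcongr; linarith
  rw [hhalf] at hp ⊢
  rcases hcases with hc | hc
  · rw [hc]
    nlinarith
  · rw [hc] at hp ⊢
    push_cast at hp
    have hq0 : (0 : ℝ) ≤ q := Nat.cast_nonneg q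
    have h0 : ((2 * q : ℕ) : ℝ) * (h / 2) = q * h := by push_cast; ring
    have h1 := b.dist_iterate_le (y := x₀) (h := h / 2) (by positivity) (2 * q)
      (by rw [h0]; linarith) (by rw [h0, dist_self]; nlinarith)
    rw [Function.iterate_succ_apply']
    set w := (fun z => X z (h / 2))^[2 * q] x₀
    have hw : w ∈ ball x₀ r := by
      rw [h0] at h1
      rw [mem_ball]
      nlinarith
    have h2 := b.dist_arc_le hw (t := h / 2) (by rw [abs_of_pos (by positivity)]; nlinarith)
    rw [abs_of_pos (by positivity), dist_comm] at h2
    have h3 := dist_triangle ((fun z => X z h)^[q] x₀) w (X w (h / 2))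
    nlinarith

theorem dist_euler_arc_le (b : UniformArcBounds X x₀ r T K Λ Ω) {s t : ℝ} (hs : 0 ≤ s)
    (hst : s ≤ t) (htT : t ≤ T) (n : ℕ) :
    dist (euler X x₀ n t) (X (euler X x₀ n s)
        (⌊t * 2 ^ n⌋₊ * (1 / 2) ^ n - ⌊s * 2 ^ n⌋₊ * (1 / 2) ^ n)) ≤
      Real.exp (T * Λ) *
        (Ω * (⌊t * 2 ^ n⌋₊ * (1 / 2) ^ n - ⌊s * 2 ^ n⌋₊ * (1 / 2) ^ n) ^ 2) := by
  have hΩ := b.Ω_pos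
  have hle : ⌊s * 2 ^ n⌋₊ ≤ ⌊t * 2 ^ n⌋₊ := Nat.floor_mono (by gcongr)
  obtain ⟨k, hk⟩ := Nat.exists_eq_add_of_le hle
  have hdiff : (⌊t * 2 ^ n⌋₊ * (1 / 2) ^ n - ⌊s * 2 ^ n⌋₊ * (1 / 2) ^ n : ℝ) =
      k * (1 / 2) ^ n := by rw [hk]; push_cast; ring
  have h1 := floor_mul_pow_le (hs.trans hst) n
  have h2 : (0 : ℝ) ≤ ⌊s * 2 ^ n⌋₊ * (1 / 2) ^ n := by positivity
  have hkT : (k : ℝ) * (1 / 2) ^ n ≤ T := by linarith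
  have hiter : euler X x₀ n t = (fun z => X z ((1 / 2) ^ n))^[k] (euler X x₀ n s) := by
    rw [euler, euler, ← Function.iterate_add_apply, hk, add_comm k]
  rw [hdiff, hiter]
  refine (b.dist_iterate_arc_le (by positivity) k hkT
    (b.dist_euler_le hs (hst.trans htT) n)).trans ?_
  gcongr
  exact b.one_add_pow_le (by positivity) k hkT

theorem exists_forward_curve (b : UniformArcBounds X x₀ r T K Λ Ω) :
    ∃ (σ : ℝ → M) (C : ℝ), 0 ≤ C ∧ σ 0 = x₀ ∧ (∀ t ∈ Icc 0 T, σ t ∈ ball x₀ r) ∧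
      ∀ s ∈ Icc 0 T, ∀ t ∈ Icc 0 T, dist (σ t) (X (σ s) (t - s)) ≤ C * (t - s) ^ 2 := by
  have hK := b.K_pos
  have hT := b.T_pos
  have hΩ := b.Ω_pos
  have hΛ := b.Λ_pos
  obtain ⟨S, hS, hbS⟩ := b.complete
  have hconv : ∀ t : ℝ, ∃ y, t ∈ Icc 0 T → Tendsto (fun n => euler X x₀ n t) atTop (𝓝 y) := by
    intro t
    by_cases ht : t ∈ Icc 0 T
    · obtain ⟨y, -, hy⟩ := cauchySeq_tendsto_of_isComplete hS
        (fun n => hbS (b.mem_ball_of_dist_le (b.dist_euler_le ht.1 ht.2 n)))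
        (cauchySeq_of_le_geometric _ _ (by norm_num) (b.dist_euler_succ_le ht.1 ht.2))
      exact ⟨y, fun _ => hy⟩
    · exact ⟨x₀, fun h => absurd h ht⟩
  choose σ hσ using hconv
  have hdist : ∀ t ∈ Icc 0 T, dist (σ t) x₀ ≤ K * T := fun t ht =>
    le_of_tendsto' ((hσ t ht).dist tendsto_const_nhds) (b.dist_euler_le ht.1 ht.2)
  set C := Real.exp (T * Λ) * Ω
  have hC0 : 0 < C := by positivity
  have hforward : ∀ s ∈ Icc 0 T, ∀ t ∈ Icc 0 T, s ≤ t →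
      dist (σ t) (X (σ s) (t - s)) ≤ C * (t - s) ^ 2 := by
    intro s hs t ht hst
    set d : ℕ → ℝ := fun n => ⌊t * 2 ^ n⌋₊ * (1 / 2) ^ n - ⌊s * 2 ^ n⌋₊ * (1 / 2) ^ n with hd
    have hdlim : Tendsto d atTop (𝓝 (t - s)) :=
      (tendsto_floor_mul_pow ht.1).sub (tendsto_floor_mul_pow hs.1)
    have hd0 : ∀ n, |d n| ≤ T := by
      intro n
      have h1 := floor_mul_pow_le ht.1 n
      have h2 : (0 : ℝ) ≤ ⌊s * 2 ^ n⌋₊ * (1 / 2) ^ n := by positivity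
      have h3 : (⌊s * 2 ^ n⌋₊ : ℝ) * (1 / 2) ^ n ≤ ⌊t * 2 ^ n⌋₊ * (1 / 2) ^ n := by
        gcongr
      rw [abs_of_nonneg (by simp only [hd]; linarith)]
      simp only [hd]
      linarith [ht.2]
    have hts : |t - s| ≤ T := by
      rw [abs_of_nonneg (by linarith)]
      linarith [hs.1, ht.2]
    have hbound : ∀ n, dist (σ t) (X (σ s) (t - s)) ≤ dist (σ t) (euler X x₀ n t) +
        C * d n ^ 2 + dist (euler X x₀ n s) (σ s) * (1 + |t - s| * Λ) + K * |d n - (t - s)| := by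
      intro n
      have hmem := b.mem_ball_of_dist_le (b.dist_euler_le hs.1 hs.2 n)
      have h1 := b.dist_euler_arc_le hs.1 hst ht.2 n
      have h2 := b.speed _ hmem (d n) (t - s) (hd0 n) hts
      have h3 := b.e1 _ hmem _ (b.mem_ball_of_dist_le (hdist s hs)) (t - s) hts
      have h4 := dist_triangle4 (σ t) (euler X x₀ n t) (X (euler X x₀ n s) (d n))
        (X (euler X x₀ n s) (t - s))
      have h5 := dist_triangle (σ t) (X (euler X x₀ n s) (t - s)) (X (σ s) (t - s))
      rw [← mul_assoc] at h1
      linarith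
    refine ge_of_tendsto' (x := atTop) ?_ hbound
    have l1 : Tendsto (fun n => dist (σ t) (euler X x₀ n t)) atTop (𝓝 0) := by
      simpa using (tendsto_const_nhds (x := σ t)).dist (hσ t ht)
    have l2 : Tendsto (fun n => dist (euler X x₀ n s) (σ s)) atTop (𝓝 0) := by
      simpa using (hσ s hs).dist (tendsto_const_nhds (x := σ s))
    have l3 := ((l1.add ((hdlim.pow 2).const_mul C)).add (l2.mul_const (1 + |t - s| * Λ))).add
      ((hdlim.sub_const (t - s)).abs.const_mul K)
    simpa using l3
  refine ⟨σ, Ω + C * (1 + T * Λ), by positivity, ?_,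
    fun t ht => b.mem_ball_of_dist_le (hdist t ht), ?_⟩
  · refine tendsto_nhds_unique (hσ 0 ⟨le_rfl, hT.le⟩) ?_
    simp [euler]
  · intro s hs t ht
    rcases le_total s t with hst | hts
    · refine (hforward s hs t ht hst).trans ?_
      gcongr
      nlinarith [mul_pos hC0 (mul_pos hT hΛ)]
    · have habs : |s - t| ≤ T := by
        rw [abs_of_nonneg (by linarith)]
        linarith [hs.2, ht.1]
      have habs' : |t - s| ≤ T := by rwa [abs_sub_comm]
      have h1 := b.e2 _ (b.mem_ball_of_dist_le (hdist t ht)) (s - t) (t - s) habs habs'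
      rw [sub_add_sub_cancel, sub_self, b.zero, show (s - t) * (t - s) = -(t - s) ^ 2 by ring,
        abs_neg, abs_of_nonneg (sq_nonneg _)] at h1
      have h2 := b.e1 _ (b.arc_mem_ball (hdist t ht) habs) _
        (b.mem_ball_of_dist_le (hdist s hs)) (t - s) habs'
      have h3 := hforward t ht s hs hts
      rw [dist_comm, ← neg_sub t s, neg_sq] at h3
      rw [← neg_sub t s] at h2 h1
      have h4 : dist (X (σ t) (-(t - s))) (σ s) * (1 + |t - s| * Λ) ≤
          C * (t - s) ^ 2 * (1 + T * Λ) := by gcongr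
      have h5 := dist_triangle (σ t) (X (X (σ t) (-(t - s))) (t - s)) (X (σ s) (t - s))
      linarith

theorem exists_solutionCurve (b : UniformArcBounds X x₀ r T K Λ Ω) :
    ∃ σ : ℝ → M, IsSolutionCurve X (Ioo (-T) T) σ x₀ := by
  have hT := b.T_pos
  have hK := b.K_pos
  obtain ⟨σ₁, C₁, hC₁, hz₁, hb₁, h₁⟩ := b.exists_forward_curve
  obtain ⟨σ₂, C₂, hC₂, hz₂, hb₂, h₂⟩ := b.reverse.exists_forward_curve
  set σ : ℝ → M := fun t => if 0 ≤ t then σ₁ t else σ₂ (-t) with hσ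
  have hpos : ∀ t, 0 ≤ t → σ t = σ₁ t := fun t ht => if_pos ht
  have hneg : ∀ t, t ≤ 0 → σ t = σ₂ (-t) := by
    intro t ht
    rcases ht.lt_or_eq with h | rfl
    · exact if_neg (not_le.2 h)
    · simp [hσ, hz₁, hz₂]
  have hmem : ∀ t ∈ Ioo (-T) T, σ t ∈ ball x₀ r := by
    intro t ht
    rcases le_total 0 t with h | h
    · rw [hpos t h]; exact hb₁ t ⟨h, ht.2.le⟩
    · rw [hneg t h]; exact hb₂ _ ⟨by linarith, by linarith [ht.1]⟩
  have hpos' : ∀ s t, 0 ≤ s → 0 ≤ t → s ≤ T → t ≤ T →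
      dist (σ t) (X (σ s) (t - s)) ≤ (C₁ + C₂) * (t - s) ^ 2 := by
    intro s t hs ht hsT htT
    rw [hpos s hs, hpos t ht]
    nlinarith [h₁ s ⟨hs, hsT⟩ t ⟨ht, htT⟩, mul_nonneg hC₂ (sq_nonneg (t - s))]
  have hneg' : ∀ s t, s ≤ 0 → t ≤ 0 → -T ≤ s → -T ≤ t →
      dist (σ t) (X (σ s) (t - s)) ≤ (C₁ + C₂) * (t - s) ^ 2 := by
    intro s t hs ht hsT htT
    rw [hneg s hs, hneg t ht]
    have := h₂ (-s) ⟨by linarith, by linarith⟩ (-t) ⟨by linarith, by linarith⟩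
    rw [show -(-t - -s) = t - s by ring, show (-t - -s) ^ 2 = (t - s) ^ 2 by ring] at this
    nlinarith [mul_nonneg hC₁ (sq_nonneg (t - s))]
  have hquad : ∀ s ∈ Ioo (-T) T, ∀ᶠ t in 𝓝 s,
      dist (σ t) (X (σ s) (t - s)) ≤ (C₁ + C₂) * (t - s) ^ 2 := by
    intro s hs
    rcases lt_trichotomy 0 s with h | rfl | h
    · filter_upwards [Ioo_mem_nhds h hs.2] with t ht
      exact hpos' s t h.le ht.1.le hs.2.le ht.2.le
    · filter_upwards [Ioo_mem_nhds hs.1 hs.2] with t ht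
      rcases le_total 0 t with h | h
      · exact hpos' 0 t le_rfl h hT.le ht.2.le
      · exact hneg' 0 t le_rfl h (by linarith) ht.1.le
    · filter_upwards [Ioo_mem_nhds hs.1 h] with t ht
      exact hneg' s t h.le ht.2.le hs.1.le ht.1.le
  refine ⟨σ, isOpen_Ioo, ordConnected_Ioo, ⟨by linarith, hT⟩, by rw [hpos 0 le_rfl, hz₁], ?_, ?_⟩
  · intro s hs
    refine ContinuousAt.continuousWithinAt ?_
    rw [ContinuousAt, tendsto_iff_dist_tendsto_zero]
    have hlim : Tendsto (fun t => (C₁ + C₂) * (t - s) ^ 2 + K * |t - s|) (𝓝 s) (𝓝 0) := by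
      have : ContinuousAt (fun t => (C₁ + C₂) * (t - s) ^ 2 + K * |t - s|) s := by fun_prop
      simpa [ContinuousAt] using this
    refine squeeze_zero' (Eventually.of_forall fun _ => dist_nonneg) ?_ hlim
    filter_upwards [hquad s hs, Ioo_mem_nhds (show s - T < s by linarith)
      (show s < s + T by linarith)] with t ht ht'
    have h1 := b.dist_arc_le (hmem s hs) (t := t - s)
      (abs_le.2 ⟨by linarith [ht'.1], by linarith [ht'.2]⟩)
    linarith [dist_triangle (σ t) (X (σ s) (t - s)) (σ s)]
  · intro s hs
    have hshift : Tendsto (fun h : ℝ => s + h) (𝓝 0) (𝓝 s) := by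
      simpa using (continuous_const_add s).tendsto 0
    have hO : (fun h : ℝ => dist (σ (s + h)) (X (σ s) h)) =O[𝓝 0] fun h => h ^ 2 := by
      refine IsBigO.of_bound (C₁ + C₂) ?_
      filter_upwards [hshift.eventually (hquad s hs)] with h hh
      simpa using hh
    exact hO.trans_isLittleO (by simpa using isLittleO_pow_id (𝕜 := ℝ) one_lt_two)

end UniformArcBounds

theorem eventually_eq_right_of_tangent {X : M → ℝ → M} {x₀ : M}
    (hE1 : ∃ r > (0 : ℝ), ∃ δ > (0 : ℝ), ∃ Λ > (0 : ℝ), ∀ x ∈ ball x₀ r, ∀ y ∈ ball x₀ r,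
      ∀ t : ℝ, |t| < δ → dist (X x t) (X y t) ≤ dist x y * (1 + |t| * Λ))
    {σ τ : ℝ → M} (hσ₀ : σ 0 = x₀) (hτ₀ : τ 0 = x₀)
    (hσ : ∀ᶠ t in 𝓝 0, ContinuousAt σ t) (hτ : ∀ᶠ t in 𝓝 0, ContinuousAt τ t)
    (hσX : ∀ᶠ t in 𝓝 0, (fun h : ℝ => dist (σ (t + h)) (X (σ t) h)) =o[𝓝 0] fun h => h)
    (hτX : ∀ᶠ t in 𝓝 0, (fun h : ℝ => dist (τ (t + h)) (X (τ t) h)) =o[𝓝 0] fun h => h) :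
    ∃ a > 0, ∀ t ∈ Ico 0 a, σ t = τ t := by
  obtain ⟨r, hr, δ, hδ, Λ, hΛ, h1⟩ := hE1
  have hσb : ∀ᶠ t in 𝓝 0, σ t ∈ ball x₀ r :=
    hσ.self_of_nhds.eventually (by rw [hσ₀]; exact ball_mem_nhds _ hr)
  have hτb : ∀ᶠ t in 𝓝 0, τ t ∈ ball x₀ r :=
    hτ.self_of_nhds.eventually (by rw [hτ₀]; exact ball_mem_nhds _ hr)
  obtain ⟨a, ha, hall⟩ := Metric.eventually_nhds_iff.1
    ((hσ.and hτ).and ((hσX.and hτX).and (hσb.and hτb)))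
  replace hall : ∀ t ∈ Ico 0 a, _ := fun t ht =>
    hall (y := t) (by rw [Real.dist_eq, sub_zero, abs_of_nonneg ht.1]; exact ht.2)
  refine ⟨a, ha, fun c hc => ?_⟩
  have hsub : ∀ t ∈ Icc 0 c, t ∈ Ico 0 a := fun t ht => ⟨ht.1, ht.2.trans_lt hc.2⟩
  have key := le_gronwallBound_of_liminf_deriv_right_le (f := fun t => dist (σ t) (τ t))
    (f' := fun t => Λ * dist (σ t) (τ t)) (δ := 0) (K := Λ) (ε := 0) (a := 0) (b := c)
    (fun t ht => ContinuousAt.continuousWithinAt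
      (Tendsto.dist (hall t (hsub t ht)).1.1 (hall t (hsub t ht)).1.2))
    ?_ (by simp [hσ₀, hτ₀]) (by simp) c ⟨hc.1, le_rfl⟩
  · rw [gronwallBound_ε0_δ0] at key
    exact dist_le_zero.1 key
  · intro x hx ρ hρ
    obtain ⟨-, ⟨hx1, hx2⟩, hx3, hx4⟩ := hall x (hsub x ⟨hx.1, hx.2.le⟩)
    have hε : 0 < (ρ - Λ * dist (σ x) (τ x)) / 3 := by linarith
    have hshift : Tendsto (fun z : ℝ => z - x) (𝓝[>] x) (𝓝 0) := by
      have : Tendsto (fun z : ℝ => z - x) (𝓝 x) (𝓝 0) := by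
        simpa using (continuous_sub_right x).tendsto x
      exact this.mono_left nhdsWithin_le_nhds
    refine Eventually.frequently ?_
    filter_upwards [hshift.eventually (hx1.bound hε), hshift.eventually (hx2.bound hε),
      hshift.eventually (Metric.ball_mem_nhds 0 hδ), self_mem_nhdsWithin] with z hz1 hz2 hz3 hz
    have hzx : 0 < z - x := sub_pos.2 hz
    have hz3' : |z - x| < δ := by simpa using hz3
    have h2 := h1 _ hx3 _ hx4 (z - x) hz3'
    rw [add_sub_cancel, Real.norm_of_nonneg dist_nonneg, Real.norm_of_nonneg hzx.le] at hz1 hz2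
    rw [abs_of_pos hzx] at h2
    have h3 := dist_triangle4 (σ z) (X (σ x) (z - x)) (X (τ x) (z - x)) (τ z)
    rw [dist_comm (τ z)] at hz2
    rw [inv_mul_lt_iff₀ hzx]
    nlinarith

namespace IsSolutionCurve

variable {X : M → ℝ → M} {I J : Set ℝ} {σ τ : ℝ → M} {x : M}

theorem eventually_eq (hE1 : CondE1 X) (hσ : IsSolutionCurve X I σ x)
    (hτ : IsSolutionCurve X J τ x) {t : ℝ} (hI : t ∈ I) (hJ : t ∈ J) (heq : σ t = τ t) :
    ∀ᶠ s in 𝓝 t, σ s = τ s := by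
  have hplus : Tendsto (fun s : ℝ => t + s) (𝓝 0) (𝓝 t) := by
    simpa using (continuous_const_add t).tendsto 0
  have hminus : Tendsto (fun s : ℝ => t - s) (𝓝 0) (𝓝 t) := by
    simpa using (continuous_sub_left t).tendsto 0
  have hright : ∃ a > 0, ∀ s ∈ Ico 0 a, σ (t + s) = τ (t + s) := by
    have hcont : ∀ {L : Set ℝ} {γ : ℝ → M}, IsSolutionCurve X L γ x → t ∈ L →
        ∀ᶠ s in 𝓝 (0 : ℝ), ContinuousAt (fun s => γ (t + s)) s := by
      intro L γ hγ hL
      filter_upwards [hplus.eventually (hγ.isOpen.mem_nhds hL)] with s hs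
      exact ContinuousAt.comp' (hγ.cont.continuousAt (hγ.isOpen.mem_nhds hs))
        (continuous_const_add t).continuousAt
    have htan : ∀ {L : Set ℝ} {γ : ℝ → M}, IsSolutionCurve X L γ x → t ∈ L →
        ∀ᶠ s in 𝓝 (0 : ℝ), (fun h : ℝ => dist (γ (t + (s + h))) (X (γ (t + s)) h)) =o[𝓝 0]
          fun h => h := by
      intro L γ hγ hL
      filter_upwards [hplus.eventually (hγ.isOpen.mem_nhds hL)] with s hs
      simpa only [add_assoc] using hγ.tangent _ hs
    exact eventually_eq_right_of_tangent (hE1 (σ t)) (by simp) (by simp [heq]) (hcont hσ hI)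
      (hcont hτ hJ) (htan hσ hI) (htan hτ hJ)
  have hleft : ∃ a > 0, ∀ s ∈ Ico 0 a, σ (t - s) = τ (t - s) := by
    have hcont : ∀ {L : Set ℝ} {γ : ℝ → M}, IsSolutionCurve X L γ x → t ∈ L →
        ∀ᶠ s in 𝓝 (0 : ℝ), ContinuousAt (fun s => γ (t - s)) s := by
      intro L γ hγ hL
      filter_upwards [hminus.eventually (hγ.isOpen.mem_nhds hL)] with s hs
      exact ContinuousAt.comp' (hγ.cont.continuousAt (hγ.isOpen.mem_nhds hs))
        (continuous_sub_left t).continuousAt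
    have htan : ∀ {L : Set ℝ} {γ : ℝ → M}, IsSolutionCurve X L γ x → t ∈ L →
        ∀ᶠ s in 𝓝 (0 : ℝ), (fun h : ℝ => dist (γ (t - (s + h))) (X (γ (t - s)) (-h))) =o[𝓝 0]
          fun h => h := by
      intro L γ hγ hL
      filter_upwards [hminus.eventually (hγ.isOpen.mem_nhds hL)] with s hs
      have hneg : Tendsto (fun h : ℝ => -h) (𝓝 0) (𝓝 0) := by
        simpa using (continuous_neg (G := ℝ)).tendsto 0
      have h1 := ((hγ.tangent _ hs).comp_tendsto hneg).trans_isBigO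
        (isBigO_refl (fun h : ℝ => h) (𝓝 0)).neg_left
      refine h1.congr_left fun h => ?_
      simp only [Function.comp_apply]
      ring_nf
    refine eventually_eq_right_of_tangent (X := fun x h => X x (-h)) (x₀ := σ t) ?_ (by simp)
      (by simp [heq]) (hcont hσ hI) (hcont hτ hJ) (htan hσ hI) (htan hτ hJ)
    obtain ⟨r, hr, δ, hδ, Λ, hΛ, h1⟩ := hE1 (σ t)
    exact ⟨r, hr, δ, hδ, Λ, hΛ, fun y hy z hz s hs => by
      simpa using h1 y hy z hz (-s) (by simpa)⟩
  obtain ⟨a, ha, hra⟩ := hright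
  obtain ⟨c, hc, hlc⟩ := hleft
  filter_upwards [Ioo_mem_nhds (show t - c < t by linarith) (show t < t + a by linarith)]
    with s hs
  rcases le_total t s with h | h
  · simpa using hra (s - t) ⟨by linarith, by linarith [hs.2]⟩
  · simpa using hlc (t - s) ⟨by linarith, by linarith [hs.1]⟩

theorem eqOn_inter (hE1 : CondE1 X) (hσ : IsSolutionCurve X I σ x)
    (hτ : IsSolutionCurve X J τ x) : EqOn σ τ (I ∩ J) := by
  have hpre : IsPreconnected (I ∩ J) :=
    (hσ.ordConnected.inter hτ.ordConnected).isPreconnected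
  have hopen : IsOpen {t | t ∈ I ∩ J ∧ σ t = τ t} := by
    rw [isOpen_iff_mem_nhds]
    rintro t ⟨ht, heq⟩
    filter_upwards [(hσ.isOpen.inter hτ.isOpen).mem_nhds ht,
      hσ.eventually_eq hE1 hτ ht.1 ht.2 heq] with s hs hs'
    exact ⟨hs, hs'⟩
  have hsub := hpre.subset_of_closure_inter_subset hopen
    ⟨0, ⟨hσ.zero_mem, hτ.zero_mem⟩, ⟨hσ.zero_mem, hτ.zero_mem⟩, by rw [hσ.init, hτ.init]⟩ ?_
  · exact fun t ht => (hsub ht).2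
  · rintro t ⟨hcl, ht⟩
    refine ⟨ht, ?_⟩
    by_contra hne
    have h1 : ∀ᶠ s in 𝓝 t, σ s ≠ τ s :=
      (Tendsto.eventually_ne (Tendsto.dist (hσ.cont.continuousAt (hσ.isOpen.mem_nhds ht.1))
        (hτ.cont.continuousAt (hτ.isOpen.mem_nhds ht.2))) (dist_ne_zero.2 hne)).mono
          fun s hs => dist_ne_zero.1 hs
    obtain ⟨s, hs, hs'⟩ := mem_closure_iff_nhds.1 hcl _ h1
    exact hs hs'.2

end IsSolutionCurve

/-- Existence and uniqueness of maximal solution curves: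
on a locally complete metric space, an arc field satisfying E1 and E2 has, through
every point, a solution curve which is unique and maximal. -/
theorem arcField_exists_unique_maximal_solution
    {M : Type*} [MetricSpace M] (hM : LocallyComplete M)
    (X : M → ℝ → M) (hX : IsArcField X) (hE1 : CondE1 X) (hE2 : CondE2 X) :
    ∀ x : M, ∃ (I : Set ℝ) (σ : ℝ → M), IsSolutionCurve X I σ x ∧
      ∀ (J : Set ℝ) (τ : ℝ → M), IsSolutionCurve X J τ x →
        J ⊆ I ∧ Set.EqOn τ σ J := by
  intro x
  set I : Set ℝ := ⋃₀ {J | ∃ τ, IsSolutionCurve X J τ x} with hI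
  have hex : ∀ t : ℝ, ∃ y, ∀ J τ, IsSolutionCurve X J τ x → t ∈ J → τ t = y := by
    intro t
    by_cases ht : t ∈ I
    · obtain ⟨J, ⟨τ, hτ⟩, htJ⟩ := ht
      exact ⟨τ t, fun J' τ' hτ' ht' => hτ'.eqOn_inter hE1 hτ ⟨ht', htJ⟩⟩
    · exact ⟨x, fun J τ hτ htJ => absurd ⟨J, ⟨τ, hτ⟩, htJ⟩ ht⟩
  choose σ hσ using hex
  have hlocal : ∀ t ∈ I, ∃ J τ, IsSolutionCurve X J τ x ∧ t ∈ J ∧ τ =ᶠ[𝓝 t] σ := by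
    rintro t ⟨J, ⟨τ, hτ⟩, htJ⟩
    refine ⟨J, τ, hτ, htJ, ?_⟩
    filter_upwards [hτ.isOpen.mem_nhds htJ] with s hs
    exact hσ s J τ hτ hs
  obtain ⟨r, T, K, Λ, Ω, b⟩ := exists_uniformArcBounds hM hX hE1 hE2 x
  obtain ⟨σ₀, hσ₀⟩ := b.exists_solutionCurve
  refine ⟨I, σ, ⟨?_, ?_, ?_, ?_, ?_, ?_⟩, fun J τ hτ =>
    ⟨subset_sUnion_of_mem ⟨τ, hτ⟩, fun t ht => hσ t J τ hτ ht⟩⟩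
  · exact isOpen_sUnion fun J hJ => hJ.elim fun τ hτ => hτ.isOpen
  · exact (isPreconnected_sUnion 0 _ (fun J hJ => hJ.elim fun τ hτ => hτ.zero_mem)
      fun J hJ => hJ.elim fun τ hτ => hτ.ordConnected.isPreconnected).ordConnected
  · exact ⟨_, ⟨σ₀, hσ₀⟩, hσ₀.zero_mem⟩
  · exact (hσ 0 _ σ₀ hσ₀ hσ₀.zero_mem).symm.trans hσ₀.init
  · intro t ht
    obtain ⟨J, τ, hτ, htJ, heq⟩ := hlocal t ht
    exact ((hτ.cont.continuousAt (hτ.isOpen.mem_nhds htJ)).congr heq).continuousWithinAt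
  · intro t ht
    obtain ⟨J, τ, hτ, htJ, heq⟩ := hlocal t ht
    have hshift : Tendsto (fun h : ℝ => t + h) (𝓝 0) (𝓝 t) := by
      simpa using (continuous_const_add t).tendsto 0
    refine (hτ.tangent t htJ).congr' ?_ EventuallyEq.rfl
    filter_upwards [hshift.eventually heq] with h hh
    rw [hh, heq.eq_of_nhds]
end

section
/- Let X be an arc field satisfying Condition E1, and let σ_x and σ_y be solution curves to X with initial conditions x and y whose domains both contain an interval I around 0. Assume the E1 estimate d(X_t(u), X_t(v)) ≤ d(u,v)(1 + |t|Λ) holds with a single constant Λ for all u, v in a set containing {σ_x(t) : t ∈ I} ∪ {σ_y(t) : t ∈ I} and all sufficiently small |t|. Then d(σ_x(t), σ_y(t)) ≤ e^{Λ|t|} d(x,y) for all t ∈ I. -/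
open Metric Set Asymptotics

variable {M : Type*} [MetricSpace M]

/-- Infinitesimal growth of the distance between two curves that are tangent at time `t` to an
arc field expanding distances by a factor of at most `1 + |h| * Λ`. -/
theorem eventually_dist_add_le {M : Type*} [MetricSpace M] {X : M → ℝ → M} {σ τ : ℝ → M}
    {t Λ : ℝ}
    (hσ : (fun h : ℝ => dist (σ (t + h)) (X (σ t) h)) =o[nhds (0 : ℝ)] fun h => h)
    (hτ : (fun h : ℝ => dist (τ (t + h)) (X (τ t) h)) =o[nhds (0 : ℝ)] fun h => h)
    (hX : ∀ᶠ h in nhds (0 : ℝ),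
      dist (X (σ t) h) (X (τ t) h) ≤ dist (σ t) (τ t) * (1 + |h| * Λ))
    {ε : ℝ} (hε : 0 < ε) :
    ∀ᶠ h in nhds (0 : ℝ),
      dist (σ (t + h)) (τ (t + h)) - dist (σ t) (τ t) ≤ |h| * (Λ * dist (σ t) (τ t) + ε) := by
  filter_upwards [hσ.bound (half_pos hε), hτ.bound (half_pos hε), hX] with h h₁ h₂ h₃
  rw [Real.norm_of_nonneg dist_nonneg, Real.norm_eq_abs] at h₁ h₂
  have h₄ := dist_triangle4 (σ (t + h)) (X (σ t) h) (X (τ t) h) (τ (t + h))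
  rw [dist_comm (X (τ t) h)] at h₄
  linarith

/-- Grönwall's inequality along the ray from `0` in direction `s`, where `|s| = 1`. -/
theorem le_mul_exp_of_eventually_sub_le {f : ℝ → ℝ} {s b K : ℝ} (hs : |s| = 1) (hb : 0 ≤ b)
    (hf : ContinuousOn (fun r => f (s * r)) (Icc 0 b))
    (h : ∀ r ∈ Ico 0 b, ∀ ε > (0 : ℝ), ∀ᶠ u in nhds (0 : ℝ),
      f (s * r + u) - f (s * r) ≤ |u| * (K * f (s * r) + ε)) :
    f (s * b) ≤ f 0 * Real.exp (K * b) := by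
  have key := le_gronwallBound_of_liminf_deriv_right_le (f := fun r => f (s * r))
    (f' := fun r => K * f (s * r)) (δ := f 0) (K := K) (ε := 0) hf ?_ (by simp)
    (fun r _ => by simp) b ⟨hb, le_rfl⟩
  · simpa [gronwallBound_ε0] using key
  intro r hr c hc
  have hlim : Filter.Tendsto (fun z => s * (z - r)) (nhdsWithin r (Ioi r)) (nhds 0) :=
    ((by fun_prop : Continuous fun z => s * (z - r)).tendsto' r 0 (by simp)).mono_left
      nhdsWithin_le_nhds
  refine Filter.Eventually.frequently ?_
  filter_upwards [hlim.eventually (h r hr ((c - K * f (s * r)) / 2) (by linarith)),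
    self_mem_nhdsWithin] with z hz hrz
  have hpos : 0 < z - r := sub_pos.2 hrz
  rw [abs_mul, hs, one_mul, abs_of_pos hpos, mul_sub, add_sub_cancel] at hz
  rw [inv_mul_lt_iff₀ hpos]
  exact hz.trans_lt (mul_lt_mul_of_pos_left (by linarith) hpos)

/-- Exponential growth estimate: if `X` satisfies E1, and the E1
estimate holds with a single constant `Λ` on a set containing two solution curves
over an interval `I` around `0`, then the solutions diverge at most exponentially. -/
theorem solutions_exp_growth
    {M : Type*} [MetricSpace M] (X : M → ℝ → M) (hX : IsArcField X) (hE1 : CondE1 X)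
    (x y : M) (Ix Iy I : Set ℝ) (σx σy : ℝ → M)
    (hσx : IsSolutionCurve X Ix σx x) (hσy : IsSolutionCurve X Iy σy y)
    (hI : I.OrdConnected) (hI0 : (0 : ℝ) ∈ I) (hIx : I ⊆ Ix) (hIy : I ⊆ Iy)
    (Λ : ℝ) (hΛ : 0 < Λ) (U : Set M)
    (hUx : ∀ t ∈ I, σx t ∈ U) (hUy : ∀ t ∈ I, σy t ∈ U)
    (hE1U : ∃ δ > (0 : ℝ), ∀ u ∈ U, ∀ v ∈ U, ∀ t : ℝ, |t| < δ →
      dist (X u t) (X v t) ≤ dist u v * (1 + |t| * Λ)) :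
    ∀ t ∈ I, dist (σx t) (σy t) ≤ Real.exp (Λ * |t|) * dist x y := by
  intro t ht
  obtain ⟨δ, hδ, hE⟩ := hE1U
  obtain ⟨s, hs, hst⟩ : ∃ s : ℝ, |s| = 1 ∧ s * |t| = t := by
    rcases le_total 0 t with h | h
    · exact ⟨1, by simp, by simp [abs_of_nonneg h]⟩
    · exact ⟨-1, by simp, by simp [abs_of_nonpos h]⟩
  have hmem : ∀ r ∈ Icc 0 |t|, s * r ∈ I := by
    intro r hr
    refine hI.uIcc_subset hI0 ht ?_
    rcases eq_or_eq_neg_of_abs_eq hs with rfl | rfl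
    · rw [← hst, mem_uIcc]
      left
      constructor <;> linarith [hr.1, hr.2]
    · rw [← hst, mem_uIcc]
      right
      constructor <;> linarith [hr.1, hr.2]
  have hcont : ContinuousOn (fun r => dist (σx (s * r)) (σy (s * r))) (Icc 0 |t|) :=
    (continuous_dist.comp_continuousOn
      ((hσx.cont.mono hIx).prodMk (hσy.cont.mono hIy))).comp
      (by fun_prop : Continuous fun r : ℝ => s * r).continuousOn hmem
  have key := le_mul_exp_of_eventually_sub_le (f := fun r => dist (σx r) (σy r)) (K := Λ) hs
    (abs_nonneg t) hcont fun r hr ε hε => by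
      have hr' := hmem r (Ico_subset_Icc_self hr)
      refine eventually_dist_add_le (hσx.tangent _ (hIx hr')) (hσy.tangent _ (hIy hr')) ?_ hε
      filter_upwards [ball_mem_nhds (0 : ℝ) hδ] with u hu
      exact hE _ (hUx _ hr') _ (hUy _ hr') u (by simpa using hu)
  simpa only [hst, hσx.init, hσy.init, mul_comm (dist x y)] using key
end

section
/- Let M be a locally complete metric space and X an arc field on M satisfying Conditions E1 and E2. Let W := {(x,t) ∈ M × ℝ : α_x < t < β_x}, where (α_x,β_x) is the domain of the unique maximal solution curve σ_x of X with initial condition x, and let F : W → M be the local flow F(x,t) := σ_x(t). Then W is open in M × ℝ and F is continuous on W. -/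
open Metric Set Asymptotics

variable {M : Type*} [MetricSpace M]

open Topology Filter

/-- Local constants for an arc field near `z`: a complete neighborhood, a speed bound, and the
constants of Conditions E1 and E2. -/
structure LocalArcBounds (X : M → ℝ → M) (z : M) (R δ K Λ Ω : ℝ) : Prop where
  R_pos : 0 < R
  δ_pos : 0 < δ
  δ_le_one : δ ≤ 1
  K_pos : 0 < K
  Λ_pos : 0 < Λ
  Ω_pos : 0 < Ω
  complete : ∃ s, ball z R ⊆ s ∧ IsComplete s
  speed : ∀ y ∈ ball z R, ∀ s ∈ Icc (-1 : ℝ) 1, ∀ t ∈ Icc (-1 : ℝ) 1,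
    dist (X y s) (X y t) ≤ K * |s - t|
  expansion : ∀ x ∈ ball z R, ∀ y ∈ ball z R, ∀ t : ℝ, |t| < δ →
    dist (X x t) (X y t) ≤ dist x y * (1 + |t| * Λ)
  semigroup : ∀ x ∈ ball z R, ∀ s t : ℝ, |s| < δ → |t| < δ →
    dist (X x (s + t)) (X (X x s) t) ≤ |s * t| * Ω

/-- A continuous curve on `[a, b]` tangent from the right to `X` on `[a, b)`. -/
structure IsRightSolution (X : M → ℝ → M) (σ : ℝ → M) (a b : ℝ) : Prop where
  cont : ContinuousOn σ (Icc a b)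
  tangent : ∀ t ∈ Ico a b, ∀ ε > (0 : ℝ), ∀ᶠ s in 𝓝[>] t,
    dist (σ s) (X (σ t) (s - t)) ≤ ε * (s - t)

/-- The time reversal of an arc field. -/
def reverseArc (X : M → ℝ → M) (x : M) (t : ℝ) : M := X x (-t)

theorem exists_localArcBounds (hM : LocallyComplete M) {X : M → ℝ → M} (hX : IsArcField X)
    (hE1 : CondE1 X) (hE2 : CondE2 X) (z : M) :
    ∃ R δ K Λ Ω : ℝ, LocalArcBounds X z R δ K Λ Ω := by
  obtain ⟨s, hs, hsc⟩ := hM z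
  obtain ⟨r₀, hr₀, hball⟩ := Metric.mem_nhds_iff.1 hs
  obtain ⟨r₁, hr₁, K, hK, hspeed⟩ := hX.2.2 z
  obtain ⟨r₂, hr₂, δ₂, hδ₂, Λ, hΛ, hexp⟩ := hE1 z
  obtain ⟨r₃, hr₃, δ₃, hδ₃, Ω, hΩ, hsemi⟩ := hE2 z
  have h0 : ball z (min (min r₀ r₁) (min r₂ r₃)) ⊆ ball z r₀ := ball_subset_ball (by simp)
  have h1 : ball z (min (min r₀ r₁) (min r₂ r₃)) ⊆ ball z r₁ := ball_subset_ball (by simp)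
  have h2 : ball z (min (min r₀ r₁) (min r₂ r₃)) ⊆ ball z r₂ := ball_subset_ball (by simp)
  have h3 : ball z (min (min r₀ r₁) (min r₂ r₃)) ⊆ ball z r₃ := ball_subset_ball (by simp)
  refine ⟨min (min r₀ r₁) (min r₂ r₃), min (min δ₂ δ₃) 1, K, Λ, Ω, by positivity, by positivity,
    min_le_right _ _, hK, hΛ, hΩ, ⟨s, h0.trans hball, hsc⟩, fun y hy => hspeed y (h1 hy),
    fun x hx y hy t ht => hexp x (h2 hx) y (h2 hy) t (ht.trans_le (by simp)),
    fun x hx s t hs ht => hsemi x (h3 hx) s t (hs.trans_le (by simp)) (ht.trans_le (by simp))⟩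

theorem isLittleO_tangent_iff {X : M → ℝ → M} {σ : ℝ → M} {t : ℝ} :
    ((fun h : ℝ => dist (σ (t + h)) (X (σ t) h)) =o[𝓝 (0 : ℝ)] fun h => h) ↔
      ∀ ε > (0 : ℝ), ∀ᶠ s in 𝓝 t, dist (σ s) (X (σ t) (s - t)) ≤ ε * |s - t| := by
  rw [isLittleO_iff]
  refine forall₂_congr fun ε _ => ?_
  constructor
  · intro h
    have h' : Tendsto (fun s : ℝ => s - t) (𝓝 t) (𝓝 0) := by
      exact Continuous.tendsto' (by fun_prop) _ _ (sub_self t)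
    filter_upwards [h'.eventually h] with s hs
    simpa using hs
  · intro h
    have h' : Tendsto (fun h : ℝ => t + h) (𝓝 0) (𝓝 t) :=
      (continuous_const.add continuous_id).tendsto' 0 t (by simp)
    filter_upwards [h'.eventually h] with s hs
    simpa using hs

theorem IsSolutionCurve.isRightSolution {X : M → ℝ → M} {I : Set ℝ} {σ : ℝ → M} {x : M}
    (h : IsSolutionCurve X I σ x) {a b : ℝ} (hab : Icc a b ⊆ I) : IsRightSolution X σ a b := by
  refine ⟨h.cont.mono hab, fun t ht ε hε => ?_⟩
  filter_upwards [((isLittleO_tangent_iff.1 (h.tangent t (hab ⟨ht.1, ht.2.le⟩))) ε hε).filter_mono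
    nhdsWithin_le_nhds, self_mem_nhdsWithin] with s hs hts
  rwa [abs_of_pos (sub_pos.2 hts)] at hs

theorem IsSolutionCurve.shift {X : M → ℝ → M} {I : Set ℝ} {σ : ℝ → M} {x : M}
    (h : IsSolutionCurve X I σ x) {s : ℝ} (hs : s ∈ I) :
    IsSolutionCurve X {t | s + t ∈ I} (fun t => σ (s + t)) (σ s) where
  isOpen := h.isOpen.preimage (continuous_const.add continuous_id)
  ordConnected := ⟨fun _ ha _ hb _ hc =>
    h.ordConnected.out ha hb ⟨by simpa using hc.1, by simpa using hc.2⟩⟩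
  zero_mem := by simpa using hs
  init := by simp
  cont := h.cont.comp (by fun_prop) fun _ ht => ht
  tangent t ht := by simpa only [add_assoc] using h.tangent (s + t) ht

theorem IsSolutionCurve.reverse {X : M → ℝ → M} {I : Set ℝ} {σ : ℝ → M} {x : M}
    (h : IsSolutionCurve X I σ x) :
    IsSolutionCurve (reverseArc X) {t | -t ∈ I} (fun t => σ (-t)) x where
  isOpen := h.isOpen.preimage continuous_neg
  ordConnected := ⟨fun _ ha _ hb _ hc =>
    h.ordConnected.out hb ha ⟨by simpa using hc.2, by simpa using hc.1⟩⟩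
  zero_mem := by simpa using h.zero_mem
  init := by simpa using h.init
  cont := h.cont.comp (by fun_prop) fun _ ht => ht
  tangent t ht := by
    refine isLittleO_tangent_iff (σ := fun t => σ (-t)).2 fun ε hε => ?_
    have h' : Tendsto (fun s : ℝ => -s) (𝓝 t) (𝓝 (-t)) := continuous_neg.tendsto t
    filter_upwards [h'.eventually (isLittleO_tangent_iff.1 (h.tangent (-t) ht) ε hε)] with s hs
    rw [← abs_neg (s - t)]
    simp only [reverseArc]
    convert hs using 3 <;> ring

theorem IsArcField.reverse {X : M → ℝ → M} (hX : IsArcField X) : IsArcField (reverseArc X) := by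
  refine ⟨?_, fun x => by simpa [reverseArc] using hX.2.1 x, fun x => ?_⟩
  · exact hX.1.comp (f := fun p : M × ℝ => (p.1, -p.2)) (by fun_prop) fun p hp =>
      ⟨trivial, by linarith [hp.2.2], by linarith [hp.2.1]⟩
  · obtain ⟨r, hr, K, hK, h⟩ := hX.2.2 x
    refine ⟨r, hr, K, hK, fun y hy s hs t ht => ?_⟩
    have := h y hy (-s) ⟨by linarith [hs.2], by linarith [hs.1]⟩ (-t)
      ⟨by linarith [ht.2], by linarith [ht.1]⟩
    rwa [← abs_neg (s - t), show -(s - t) = -s - -t by ring]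

theorem CondE1.reverse {X : M → ℝ → M} (hE : CondE1 X) : CondE1 (reverseArc X) := fun x => by
  obtain ⟨r, hr, δ, hδ, Λ, hΛ, h⟩ := hE x
  refine ⟨r, hr, δ, hδ, Λ, hΛ, fun x hx y hy t ht => ?_⟩
  simpa [reverseArc] using h x hx y hy (-t) (by simpa using ht)

theorem CondE2.reverse {X : M → ℝ → M} (hE : CondE2 X) : CondE2 (reverseArc X) := fun x => by
  obtain ⟨r, hr, δ, hδ, Ω, hΩ, h⟩ := hE x
  refine ⟨r, hr, δ, hδ, Ω, hΩ, fun x hx s t hs ht => ?_⟩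
  have := h x hx (-s) (-t) (by simpa using hs) (by simpa using ht)
  rwa [show -s + -t = -(s + t) by ring, neg_mul_neg] at this

/-- Grönwall's inequality for functions with forward increments at most
`(Λ f + c) h + o(h)`. -/
theorem le_gronwallBound_of_eventually_le {f : ℝ → ℝ} {a b Λ c : ℝ}
    (hf : ContinuousOn f (Icc a b))
    (h : ∀ t ∈ Ico a b, ∀ ε > (0 : ℝ), ∀ᶠ s in 𝓝[>] t,
      f s ≤ f t + (Λ * f t + c + ε) * (s - t)) :
    ∀ t ∈ Icc a b, f t ≤ gronwallBound (f a) Λ c (t - a) := by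
  refine le_gronwallBound_of_liminf_deriv_right_le (f' := fun t => Λ * f t + c) hf ?_ le_rfl
    fun _ _ => le_rfl
  intro t ht r hr
  refine Eventually.frequently ?_
  filter_upwards [h t ht ((r - (Λ * f t + c)) / 2) (by linarith), self_mem_nhdsWithin]
    with s hs hts
  have hpos : 0 < s - t := sub_pos.2 hts
  rw [inv_mul_lt_iff₀ hpos]
  nlinarith

namespace LocalArcBounds

variable {X : M → ℝ → M} {z : M} {R δ K Λ Ω : ℝ}

theorem dist_arc_le (H : LocalArcBounds X z R δ K Λ Ω) (h0 : ∀ x, X x 0 = x) {y : M}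
    (hy : y ∈ ball z R) {t : ℝ} (ht : |t| ≤ 1) : dist (X y t) y ≤ K * |t| := by
  simpa [h0] using H.speed y hy t (abs_le.1 ht) 0 (by simp)

/-- A curve starting well inside the ball moves with speed at most `K + 1`. -/
theorem dist_le_mul_of_isRightSolution (H : LocalArcBounds X z R δ K Λ Ω) (hX : IsArcField X)
    {σ : ℝ → M} {a b : ℝ} (hσ : IsRightSolution X σ a b)
    (hR : dist (σ a) z + (K + 1) * (b - a) < R) :
    ∀ t ∈ Icc a b, dist (σ t) (σ a) ≤ (K + 1) * (t - a) := by
  have hk : ∀ y : M, ∃ k : ℝ, (y ∈ ball z R → k = K) ∧ ∀ t : ℝ, |t| ≤ 1 →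
      dist (X y t) y ≤ k * |t| := by
    intro y
    by_cases hy : y ∈ ball z R
    · exact ⟨K, fun _ => rfl, fun t ht => H.dist_arc_le hX.2.1 hy ht⟩
    · obtain ⟨r, hr, k, -, h⟩ := hX.2.2 y
      refine ⟨k, fun h => absurd h hy, fun t ht => ?_⟩
      simpa [hX.2.1] using h y (mem_ball_self hr) t (abs_le.1 ht) 0 (by simp)
  choose k hkK hk using hk
  refine image_le_of_liminf_slope_right_lt_deriv_boundary
    (f := fun t => dist (σ t) (σ a)) (f' := fun t => k (σ t))
    (B := fun t => (K + 1) * (t - a)) (B' := fun _ => K + 1)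
    (continuous_dist.comp_continuousOn (hσ.cont.prodMk continuousOn_const)) ?_ (by simp) ?_ ?_
  · intro t ht r hr
    refine Eventually.frequently ?_
    have h1 : ∀ᶠ s in 𝓝[>] t, s < t + 1 :=
      nhdsWithin_le_nhds (eventually_lt_nhds (by linarith))
    filter_upwards [hσ.tangent t ht ((r - k (σ t)) / 2) (by linarith), self_mem_nhdsWithin, h1]
      with s hs hts hs1
    have hpos : 0 < s - t := sub_pos.2 hts
    have h2 := hk (σ t) (s - t) (by rw [abs_of_pos hpos]; linarith)
    rw [abs_of_pos hpos] at h2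
    have h3 := dist_triangle (σ s) (X (σ t) (s - t)) (σ t)
    have h4 := dist_triangle (σ s) (σ t) (σ a)
    rw [slope_def_field, div_lt_iff₀ hpos]
    nlinarith
  · intro t
    simpa using ((hasDerivAt_id t).sub_const a).const_mul (K + 1)
  · intro t ht heq
    have hmem : σ t ∈ ball z R := by
      rw [mem_ball]
      have h1 := dist_triangle (σ t) (σ a) z
      have h2 : (K + 1) * (t - a) ≤ (K + 1) * (b - a) := by
        have := H.K_pos
        have := ht.2
        gcongr
      linarith
    simp [hkK _ hmem]

theorem mem_ball_of_isRightSolution (H : LocalArcBounds X z R δ K Λ Ω) (hX : IsArcField X)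
    {σ : ℝ → M} {a b : ℝ} (hσ : IsRightSolution X σ a b)
    (hR : dist (σ a) z + (K + 1) * (b - a) < R) {t : ℝ} (ht : t ∈ Icc a b) :
    σ t ∈ ball z R := by
  have h1 := H.dist_le_mul_of_isRightSolution hX hσ hR t ht
  have h2 := dist_triangle (σ t) (σ a) z
  have h3 : (K + 1) * (t - a) ≤ (K + 1) * (b - a) := by
    have := H.K_pos
    have := ht.2
    gcongr
  rw [mem_ball]
  linarith

/-- Two solutions in the ball separate at most exponentially. -/
theorem dist_le_exp_mul (H : LocalArcBounds X z R δ K Λ Ω)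
    {σ τ : ℝ → M} {a b : ℝ} (hσ : IsRightSolution X σ a b) (hτ : IsRightSolution X τ a b)
    (hσR : ∀ t ∈ Icc a b, σ t ∈ ball z R) (hτR : ∀ t ∈ Icc a b, τ t ∈ ball z R) :
    ∀ t ∈ Icc a b, dist (σ t) (τ t) ≤ dist (σ a) (τ a) * Real.exp (Λ * (t - a)) := by
  intro t ht
  rw [← gronwallBound_ε0]
  refine le_gronwallBound_of_eventually_le (f := fun t => dist (σ t) (τ t))
    (continuous_dist.comp_continuousOn (hσ.cont.prodMk hτ.cont)) ?_ t ht
  intro t ht ε hε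
  have h1 : ∀ᶠ s in 𝓝[>] t, s < t + δ :=
    nhdsWithin_le_nhds (eventually_lt_nhds (by linarith [H.δ_pos]))
  filter_upwards [hσ.tangent t ht (ε / 2) (by linarith), hτ.tangent t ht (ε / 2) (by linarith),
    self_mem_nhdsWithin, h1] with s hs hs' hts hsδ
  have hpos : 0 < s - t := sub_pos.2 hts
  have ht' := Ico_subset_Icc_self ht
  have h2 := H.expansion _ (hσR t ht') _ (hτR t ht') (s - t) (by rw [abs_of_pos hpos]; linarith)
  rw [abs_of_pos hpos] at h2
  rw [dist_comm] at hs'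
  have h3 := dist_triangle4 (σ s) (X (σ t) (s - t)) (X (τ t) (s - t)) (τ s)
  linarith

/-- A solution is approximated to second order by the arcs of the field. -/
theorem dist_arc_le_sq (H : LocalArcBounds X z R δ K Λ Ω) (hX : IsArcField X)
    {σ : ℝ → M} {a b : ℝ} (hσ : IsRightSolution X σ a b) (hab : a ≤ b) (hδ : b - a < δ)
    (hR : dist (σ a) z + (K + 1) * (b - a) < R) :
    dist (σ b) (X (σ a) (b - a)) ≤ Ω * Real.exp Λ * (b - a) ^ 2 := by
  have hΛ := H.Λ_pos
  have hΩ := H.Ω_pos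
  have hδ1 := H.δ_le_one
  have hK := H.K_pos
  have hσa : σ a ∈ ball z R := H.mem_ball_of_isRightSolution hX hσ hR ⟨le_rfl, hab⟩
  have harc : ∀ t ∈ Icc a b, X (σ a) (t - a) ∈ ball z R := by
    intro t ht
    have ht0 : 0 ≤ t - a := sub_nonneg.2 ht.1
    have h1 := H.dist_arc_le hX.2.1 hσa (t := t - a) (by rw [abs_of_nonneg ht0]; linarith [ht.2])
    rw [abs_of_nonneg ht0] at h1
    have h2 := dist_triangle (X (σ a) (t - a)) (σ a) z
    have h3 : K * (t - a) ≤ (K + 1) * (b - a) := by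
      have := ht.2
      gcongr
      linarith
    rw [mem_ball]
    linarith
  have hcont : ContinuousOn (fun t => X (σ a) (t - a)) (Icc a b) := by
    refine hX.1.comp (f := fun t : ℝ => (σ a, t - a)) (by fun_prop) fun t ht => ⟨trivial, ?_, ?_⟩
    · change -1 ≤ t - a
      linarith [ht.1]
    · change t - a ≤ 1
      linarith [ht.2]
  have key := le_gronwallBound_of_eventually_le (f := fun t => dist (σ t) (X (σ a) (t - a)))
    (Λ := Λ) (c := Ω * (b - a)) (continuous_dist.comp_continuousOn (hσ.cont.prodMk hcont)) ?_ b ⟨hab, le_rfl⟩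
  · refine key.trans ?_
    simp only [sub_self, hX.2.1, dist_self]
    rw [gronwallBound_of_K_ne_0 hΛ.ne']
    have h1 : Real.exp (Λ * (b - a)) - 1 ≤ Λ * (b - a) * Real.exp Λ := by
      have h2 := Real.add_one_le_exp (-(Λ * (b - a)))
      have h3 : Real.exp (Λ * (b - a)) ≤ Real.exp Λ := by
        apply Real.exp_le_exp.2
        nlinarith
      have h4 : Real.exp (-(Λ * (b - a))) * Real.exp (Λ * (b - a)) = 1 := by
        rw [← Real.exp_add]; simp
      have h5 : 0 ≤ Λ * (b - a) := mul_nonneg hΛ.le (sub_nonneg.2 hab)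
      nlinarith [Real.exp_pos (Λ * (b - a))]
    calc 0 * Real.exp (Λ * (b - a)) + Ω * (b - a) / Λ * (Real.exp (Λ * (b - a)) - 1)
        ≤ Ω * (b - a) / Λ * (Λ * (b - a) * Real.exp Λ) := by
          rw [zero_mul, zero_add]
          have := sub_nonneg.2 hab
          gcongr
      _ = Ω * Real.exp Λ * (b - a) ^ 2 := by
          field_simp
  · intro t ht ε hε
    have h1 : ∀ᶠ s in 𝓝[>] t, s < t + δ :=
      nhdsWithin_le_nhds (eventually_lt_nhds (by linarith [H.δ_pos]))
    filter_upwards [hσ.tangent t ht ε hε, self_mem_nhdsWithin, h1] with s hs hts hsδ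
    have hpos : 0 < s - t := sub_pos.2 hts
    have ht0 : 0 ≤ t - a := sub_nonneg.2 ht.1
    have ht' := Ico_subset_Icc_self ht
    have hsmall : |s - t| < δ := by rw [abs_of_pos hpos]; linarith
    have h2 := H.expansion _ (H.mem_ball_of_isRightSolution hX hσ hR ht') _ (harc t ht')
      (s - t) hsmall
    have h3 := H.semigroup _ hσa (t - a) (s - t)
      (by rw [abs_of_nonneg ht0]; linarith [ht.2]) hsmall
    rw [abs_of_nonneg (mul_nonneg ht0 hpos.le), dist_comm, show t - a + (s - t) = s - a by ring]
      at h3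
    rw [abs_of_pos hpos] at h2
    have h4 := dist_triangle4 (σ s) (X (σ t) (s - t)) (X (X (σ a) (t - a)) (s - t))
      (X (σ a) (s - a))
    have h5 : (t - a) * (s - t) * Ω ≤ (b - a) * (s - t) * Ω := by
      have := ht.2.le
      gcongr
    linarith

end LocalArcBounds

theorem LocalArcBounds.dist_arc_neg_le_sq {X : M → ℝ → M} {z : M} {R δ K Λ Ω : ℝ}
    (H : LocalArcBounds X z R δ K Λ Ω) (hX : IsArcField X)
    {σ : ℝ → M} {a b : ℝ} (hσ : IsRightSolution X σ a b) (hab : a ≤ b) (hδ : b - a < δ)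
    (hR : dist (σ a) z + (K + 1) * (b - a) < R) :
    dist (σ a) (X (σ b) (a - b)) ≤ (Ω + Ω * Real.exp Λ * (1 + Λ)) * (b - a) ^ 2 := by
  have hΛ := H.Λ_pos
  have hΩ := H.Ω_pos
  have hδ1 := H.δ_le_one
  have hK := H.K_pos
  have hba : 0 ≤ b - a := sub_nonneg.2 hab
  have hσa : σ a ∈ ball z R := H.mem_ball_of_isRightSolution hX hσ hR ⟨le_rfl, hab⟩
  have hσb : σ b ∈ ball z R := H.mem_ball_of_isRightSolution hX hσ hR ⟨hab, le_rfl⟩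
  have harc : X (σ a) (b - a) ∈ ball z R := by
    have h1 := H.dist_arc_le hX.2.1 hσa (t := b - a) (by rw [abs_of_nonneg hba]; linarith)
    rw [abs_of_nonneg hba] at h1
    have h2 := dist_triangle (X (σ a) (b - a)) (σ a) z
    rw [mem_ball]
    linarith
  have habs : |a - b| = b - a := by rw [abs_sub_comm, abs_of_nonneg hba]
  have h1 := H.dist_arc_le_sq hX hσ hab hδ hR
  have h2 := H.expansion _ harc _ hσb (a - b) (by rwa [habs])
  have h3 := H.semigroup _ hσa (b - a) (a - b) (by rwa [abs_of_nonneg hba]) (by rwa [habs])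
  rw [abs_mul, habs, abs_of_nonneg hba, show b - a + (a - b) = 0 by ring, hX.2.1] at h3
  rw [habs, dist_comm (X (σ a) (b - a))] at h2
  have h4 : dist (σ b) (X (σ a) (b - a)) * (1 + (b - a) * Λ) ≤
      Ω * Real.exp Λ * (b - a) ^ 2 * (1 + 1 * Λ) := by
    gcongr
    linarith
  have h5 := dist_triangle (σ a) (X (X (σ a) (b - a)) (a - b)) (X (σ b) (a - b))
  linarith

/-- A solution curve with a limit at the right endpoint `β`, tangent there from the left to the
field, continues beyond `β` along a solution curve starting at the limit point. -/
theorem IsSolutionCurve.exists_extension {X : M → ℝ → M} {I J : Set ℝ} {σ τ : ℝ → M} {x y : M}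
    (hσ : IsSolutionCurve X I σ x) (hτ : IsSolutionCurve X J τ y) {β : ℝ} (hβ : 0 < β)
    (hI : Ico 0 β ⊆ I) (hlim : Tendsto σ (𝓝[<] β) (𝓝 y))
    (hleft : ∀ ε > (0 : ℝ), ∀ᶠ s in 𝓝[<] β, dist (σ s) (X y (s - β)) ≤ ε * (β - s)) :
    ∃ (J' : Set ℝ) (σ' : ℝ → M), IsSolutionCurve X J' σ' x ∧ β ∈ J' := by
  obtain ⟨η₁, hη₁, hηI⟩ := Metric.isOpen_iff.1 hσ.isOpen 0 hσ.zero_mem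
  obtain ⟨η₂, hη₂, hηJ⟩ := Metric.isOpen_iff.1 hτ.isOpen 0 hτ.zero_mem
  rw [Real.ball_eq_Ioo] at hηI hηJ
  set σ' : ℝ → M := fun t => if t < β then σ t else τ (t - β)
  have hlt : ∀ t < β, σ' t = σ t := fun t ht => if_pos ht
  have hge : ∀ t, β ≤ t → σ' t = τ (t - β) := fun t ht => if_neg ht.not_gt
  have hσ'β : σ' β = y := by rw [hge β le_rfl, sub_self, hτ.init]
  have hmem : ∀ t ∈ Ioo (-η₁) (β + η₂), t < β → t ∈ I := by
    intro t ht htβ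
    rcases le_or_gt 0 t with h | h
    · exact hI ⟨h, htβ⟩
    · exact hηI ⟨by linarith [ht.1], by linarith⟩
  have hmem' : ∀ t ∈ Ioo (-η₁) (β + η₂), β ≤ t → t - β ∈ J := fun t ht htβ =>
    hηJ ⟨by linarith, by linarith [ht.2]⟩
  have hsub : ∀ t : ℝ, Tendsto (fun s : ℝ => s - β) (𝓝 t) (𝓝 (t - β)) := fun t =>
    Continuous.tendsto (by fun_prop) t
  refine ⟨Ioo (-η₁) (β + η₂), σ', ⟨isOpen_Ioo, ordConnected_Ioo, ⟨by linarith, by linarith⟩,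
    (hlt 0 hβ).trans hσ.init, fun t ht => ContinuousAt.continuousWithinAt ?_, fun t ht => ?_⟩,
    ⟨by linarith, by linarith⟩⟩
  · rcases lt_trichotomy t β with h | h | h
    · refine (hσ.cont.continuousAt (hσ.isOpen.mem_nhds (hmem t ht h))).congr ?_
      filter_upwards [eventually_lt_nhds h] with s hs using (hlt s hs).symm
    · subst h
      rw [continuousAt_iff_continuous_left'_right']
      constructor
      · rw [ContinuousWithinAt, hσ'β]
        refine hlim.congr' ?_
        filter_upwards [self_mem_nhdsWithin] with s hs using (hlt s hs).symm
      · have h0 : ContinuousAt τ (t - t) := by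
          rw [sub_self]
          exact hτ.cont.continuousAt (hτ.isOpen.mem_nhds hτ.zero_mem)
        rw [ContinuousWithinAt, hge t le_rfl]
        refine ((h0.tendsto.comp (hsub t)).mono_left nhdsWithin_le_nhds).congr' ?_
        filter_upwards [self_mem_nhdsWithin] with s hs using (hge s (le_of_lt hs)).symm
    · have h0 := hτ.cont.continuousAt (hτ.isOpen.mem_nhds (hmem' t ht h.le))
      refine ContinuousAt.congr (h0.tendsto.comp (hsub t)) ?_
      filter_upwards [eventually_gt_nhds h] with s hs using (hge s (le_of_lt hs)).symm
  · rw [isLittleO_tangent_iff]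
    intro ε hε
    rcases lt_trichotomy t β with h | h | h
    · filter_upwards [isLittleO_tangent_iff.1 (hσ.tangent t (hmem t ht h)) ε hε,
        eventually_lt_nhds h] with s hs hsβ
      rwa [hlt s hsβ, hlt t h]
    · subst h
      have h0 := isLittleO_tangent_iff.1 (hτ.tangent 0 hτ.zero_mem) ε hε
      have h1 : Tendsto (fun s : ℝ => s - t) (𝓝 t) (𝓝 0) := by simpa using hsub t
      filter_upwards [h1.eventually h0, eventually_nhdsWithin_iff.1 (hleft ε hε)] with s hs hs'
      rw [hσ'β]
      rcases lt_or_ge s t with hst | hst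
      · rw [hlt s hst, abs_sub_comm, abs_of_pos (sub_pos.2 hst)]
        exact hs' hst
      · rw [hge s hst]
        simpa [hτ.init] using hs
    · filter_upwards [(hsub t).eventually
        (isLittleO_tangent_iff.1 (hτ.tangent _ (hmem' t ht h.le)) ε hε),
        eventually_gt_nhds h] with s hs hsβ
      rw [hge s (le_of_lt hsβ), hge t h.le]
      simpa using hs

/-- `F` assigns to each `x` the unique maximal solution curve of `X` starting at `x`, with
domain `I x`. -/
def IsMaximalFlow (X : M → ℝ → M) (I : M → Set ℝ) (F : M → ℝ → M) : Prop :=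
  ∀ x : M, IsSolutionCurve X (I x) (F x) x ∧
    ∀ (J : Set ℝ) (τ : ℝ → M), IsSolutionCurve X J τ x → J ⊆ I x ∧ Set.EqOn τ (F x) J

namespace IsMaximalFlow

variable {X : M → ℝ → M} {I : M → Set ℝ} {F : M → ℝ → M}

theorem reverse (hF : IsMaximalFlow X I F) :
    IsMaximalFlow (reverseArc X) (fun x => {t | -t ∈ I x}) (fun x t => F x (-t)) := by
  refine fun x => ⟨(hF x).1.reverse, fun J τ hτ => ?_⟩
  have h1 : IsSolutionCurve X {t | -t ∈ J} (fun t => τ (-t)) x := by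
    have h2 : reverseArc (reverseArc X) = X := by
      ext x t
      simp [reverseArc]
    simpa only [h2] using hτ.reverse
  obtain ⟨h3, h4⟩ := (hF x).2 _ _ h1
  refine ⟨fun t ht => h3 (by simpa using ht), fun t ht => ?_⟩
  simpa using h4 (x := -t) (by simpa using ht)

theorem add (hF : IsMaximalFlow X I F) {x : M} {s t : ℝ} (hs : s ∈ I x) (ht : t ∈ I (F x s)) :
    s + t ∈ I x ∧ F x (s + t) = F (F x s) t := by
  have h1 := (hF (F x s)).2 _ _ ((hF x).1.shift hs)
  have h2 : -s ∈ {t | s + t ∈ I x} := by simpa using (hF x).1.zero_mem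
  have h3 : F (F x s) (-s) = x := by
    have h := h1.2 h2
    simp only [add_neg_cancel] at h
    rw [← h, (hF x).1.init]
  have h4 := (hF (F x s)).1.shift (h1.1 h2)
  rw [h3] at h4
  obtain ⟨h5, h6⟩ := (hF x).2 _ _ h4
  have h7 : s + t ∈ {u | -s + u ∈ I (F x s)} := by simpa using ht
  refine ⟨h5 h7, ?_⟩
  simpa using (h6 h7).symm

theorem Icc_subset (hF : IsMaximalFlow X I F) (hX : IsArcField X) {z : M} {R δ K Λ Ω : ℝ}
    (H : LocalArcBounds X z R δ K Λ Ω) {x : M} {T : ℝ} (hT : dist x z + (K + 1) * T < R) :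
    Icc 0 T ⊆ I x := by
  by_contra hcon
  obtain ⟨T₁, hT₁, hT₁I⟩ := not_subset.1 hcon
  have hK := H.K_pos
  have hΛ := H.Λ_pos
  have hΩ := H.Ω_pos
  have hsol := (hF x).1
  have hbdd : BddBelow ((I x)ᶜ ∩ Ici 0) := ⟨0, fun t ht => ht.2⟩
  have hβmem : sInf ((I x)ᶜ ∩ Ici 0) ∈ (I x)ᶜ ∩ Ici 0 :=
    (hsol.isOpen.isClosed_compl.inter isClosed_Ici).csInf_mem ⟨T₁, hT₁I, hT₁.1⟩ hbdd
  have hβT : sInf ((I x)ᶜ ∩ Ici 0) ≤ T := (csInf_le hbdd ⟨hT₁I, hT₁.1⟩).trans hT₁.2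
  have hI : Ico 0 (sInf ((I x)ᶜ ∩ Ici 0)) ⊆ I x := fun t ht => by
    by_contra h
    exact notMem_of_lt_csInf ht.2 hbdd ⟨h, ht.1⟩
  generalize sInf ((I x)ᶜ ∩ Ici 0) = β at hβmem hβT hI
  have hβ : 0 < β := lt_of_le_of_ne hβmem.2 fun h => hβmem.1 (h ▸ hsol.zero_mem)
  have hright : ∀ a b : ℝ, 0 ≤ a → b < β → IsRightSolution X (F x) a b := fun a b ha hb =>
    hsol.isRightSolution fun t ht => hI ⟨ha.trans ht.1, ht.2.trans_lt hb⟩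
  have hinit : ∀ t, t < β → dist (F x 0) z + (K + 1) * (t - 0) < R := by
    intro t ht
    rw [hsol.init, sub_zero]
    have : (K + 1) * t ≤ (K + 1) * T := by gcongr; linarith
    linarith
  have hstart : ∀ a b : ℝ, 0 ≤ a → a ≤ b → b < β →
      dist (F x a) z + (K + 1) * (b - a) < R := by
    intro a b ha hab hb
    have h1 := H.dist_le_mul_of_isRightSolution hX (hright 0 b le_rfl hb) (hinit b hb) a ⟨ha, hab⟩
    have h2 := dist_triangle (F x a) (F x 0) z
    have h3 := hinit b hb
    linarith
  have hlip : ∀ a b : ℝ, 0 ≤ a → a ≤ b → b < β →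
      dist (F x b) (F x a) ≤ (K + 1) * (b - a) := fun a b ha hab hb =>
    H.dist_le_mul_of_isRightSolution hX (hright a b ha hb) (hstart a b ha hab hb) b ⟨hab, le_rfl⟩
  have hcauchy : Cauchy (map (F x) (𝓝[<] β)) := by
    rw [Metric.cauchy_iff]
    refine ⟨inferInstance, fun ε hε => ?_⟩
    refine ⟨F x '' Ioo (max 0 (β - ε / (K + 1))) β,
      image_mem_map (Ioo_mem_nhdsLT (max_lt hβ (sub_lt_self _ (by positivity)))), ?_⟩
    have key : ∀ a b : ℝ, max 0 (β - ε / (K + 1)) < a → a ≤ b → b < β →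
        dist (F x b) (F x a) < ε := by
      intro a b ha hab hb
      obtain ⟨ha0, ha1⟩ := max_lt_iff.1 ha
      refine (hlip a b ha0.le hab hb).trans_lt ?_
      rw [← lt_div_iff₀' (by positivity)]
      linarith
    rintro _ ⟨a, ha, rfl⟩ _ ⟨b, hb, rfl⟩
    rcases le_total a b with h | h
    · rw [dist_comm]
      exact key a b ha.1 h hb.2
    · exact key b a hb.1 h ha.2
  obtain ⟨s, hs, hsc⟩ := H.complete
  have hev : ∀ᶠ t in 𝓝[<] β, 0 < t ∧ t < β := Ioo_mem_nhdsLT hβ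
  obtain ⟨y, -, hy⟩ := hsc _ hcauchy (by
    rw [le_principal_iff, mem_map]
    filter_upwards [hev] with t ht
    exact hs (H.mem_ball_of_isRightSolution hX (hright 0 t le_rfl ht.2) (hinit t ht.2)
      ⟨ht.1.le, le_rfl⟩))
  have hlim : Tendsto (F x) (𝓝[<] β) (𝓝 y) := hy
  set C := Ω + Ω * Real.exp Λ * (1 + Λ)
  have hCpos : 0 < C := by positivity
  have hquad : ∀ s, 0 ≤ s → β - δ < s → s < β → dist (F x s) (X y (s - β)) ≤ C * (β - s) ^ 2 := by
    intro s hs0 hsδ hsβ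
    have hδ1 := H.δ_le_one
    have hcont : ContinuousAt (fun p : M × ℝ => X p.1 p.2) (y, s - β) :=
      hX.1.continuousAt (prod_mem_nhds univ_mem (Icc_mem_nhds (by linarith) (by linarith)))
    have hsub : Tendsto (fun t : ℝ => s - t) (𝓝[<] β) (𝓝 (s - β)) :=
      (Continuous.tendsto (by fun_prop) β).mono_left nhdsWithin_le_nhds
    have hl : Tendsto (fun t => dist (F x s) (X (F x t) (s - t))) (𝓝[<] β)
        (𝓝 (dist (F x s) (X y (s - β)))) :=
      tendsto_const_nhds.dist (hcont.tendsto.comp (hlim.prodMk_nhds hsub))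
    have hr : Tendsto (fun t : ℝ => C * (t - s) ^ 2) (𝓝[<] β) (𝓝 (C * (β - s) ^ 2)) :=
      (Continuous.tendsto (by fun_prop) β).mono_left nhdsWithin_le_nhds
    refine le_of_tendsto_of_tendsto hl hr ?_
    filter_upwards [Ioo_mem_nhdsLT hsβ] with t ht
    exact H.dist_arc_neg_le_sq hX (hright s t hs0 ht.2) ht.1.le (by linarith [ht.2])
      (hstart s t hs0 ht.1.le ht.2)
  obtain ⟨J', σ', hσ', hβJ⟩ := hsol.exists_extension (hF y).1 hβ hI hlim fun ε hε => by
    have h1 : max 0 (max (β - δ) (β - ε / C)) < β :=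
      max_lt hβ (max_lt (sub_lt_self _ H.δ_pos) (sub_lt_self _ (by positivity)))
    filter_upwards [Ioo_mem_nhdsLT h1] with s hs
    obtain ⟨hs0, hs1, hs2⟩ : 0 < s ∧ β - δ < s ∧ β - ε / C < s := by
      simpa only [max_lt_iff] using hs.1
    refine (hquad s hs0.le hs1 hs.2).trans ?_
    have h2 : C * (β - s) ≤ ε := by
      rw [← le_div_iff₀' hCpos]
      linarith
    nlinarith [sub_pos.2 hs.2]
  exact hβmem.1 (((hF x).2 _ _ hσ').1 hβJ)

/-- Near each point the flow is defined for a uniform positive time and is uniformly Lipschitz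
in the initial condition. -/
theorem exists_forward_lipschitz (hF : IsMaximalFlow X I F) (hM : LocallyComplete M)
    (hX : IsArcField X) (hE1 : CondE1 X) (hE2 : CondE2 X) (z : M) :
    ∃ r > (0 : ℝ), ∃ T > (0 : ℝ), ∃ L : NNReal, ∀ t ∈ Icc 0 T, (∀ x ∈ ball z r, t ∈ I x) ∧
      LipschitzOnWith L (fun x => F x t) (ball z r) := by
  obtain ⟨R, δ, K, Λ, Ω, H⟩ := exists_localArcBounds hM hX hE1 hE2 z
  have hR := H.R_pos
  have hK := H.K_pos
  have hΛ := H.Λ_pos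
  have hT : ∀ x ∈ ball z (R / 2), dist x z + (K + 1) * (R / (2 * (K + 1))) < R := by
    intro x hx
    have h1 : (K + 1) * (R / (2 * (K + 1))) = R / 2 := by field_simp
    rw [mem_ball] at hx
    linarith
  have hball : ∀ x ∈ ball z (R / 2), ∀ t ∈ Icc 0 (R / (2 * (K + 1))),
      F x t ∈ ball z R := fun x hx t ht =>
    H.mem_ball_of_isRightSolution hX ((hF x).1.isRightSolution (hF.Icc_subset hX H (hT x hx)))
      (by simpa [(hF x).1.init] using hT x hx) ht
  refine ⟨R / 2, by positivity, R / (2 * (K + 1)), by positivity,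
    .mk (Real.exp (Λ * (R / (2 * (K + 1))))) (Real.exp_pos _).le, fun t ht => ⟨fun x hx =>
      hF.Icc_subset hX H (hT x hx) ht, LipschitzOnWith.of_dist_le_mul fun x hx y hy => ?_⟩⟩
  have h1 := H.dist_le_exp_mul ((hF x).1.isRightSolution (hF.Icc_subset hX H (hT x hx)))
    ((hF y).1.isRightSolution (hF.Icc_subset hX H (hT y hy))) (hball x hx) (hball y hy) t ht
  rw [(hF x).1.init, (hF y).1.init, sub_zero, mul_comm] at h1
  refine h1.trans ?_
  rw [NNReal.coe_mk]
  have := ht.2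
  gcongr

theorem exists_local_continuousOn (hF : IsMaximalFlow X I F) (hM : LocallyComplete M)
    (hX : IsArcField X) (hE1 : CondE1 X) (hE2 : CondE2 X) (z : M) :
    ∃ r > (0 : ℝ), ∃ T > (0 : ℝ), (∀ x ∈ ball z r, ∀ t ∈ Ioo (-T) T, t ∈ I x) ∧
      ContinuousOn (fun p : M × ℝ => F p.1 p.2) (ball z r ×ˢ Ioo (-T) T) := by
  obtain ⟨r₁, hr₁, T₁, hT₁, L₁, h₁⟩ := hF.exists_forward_lipschitz hM hX hE1 hE2 z
  obtain ⟨r₂, hr₂, T₂, hT₂, L₂, h₂⟩ :=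
    hF.reverse.exists_forward_lipschitz hM hX.reverse hE1.reverse hE2.reverse z
  have hball₁ : ball z (min r₁ r₂) ⊆ ball z r₁ := ball_subset_ball (min_le_left _ _)
  have hball₂ : ball z (min r₁ r₂) ⊆ ball z r₂ := ball_subset_ball (min_le_right _ _)
  have key : ∀ t ∈ Ioo (-min T₁ T₂) (min T₁ T₂), (∀ x ∈ ball z (min r₁ r₂), t ∈ I x) ∧
      LipschitzOnWith (max L₁ L₂) (fun x => F x t) (ball z (min r₁ r₂)) := by
    intro t ht
    rcases le_total 0 t with h | h
    · obtain ⟨h3, h4⟩ := h₁ t ⟨h, ht.2.le.trans (min_le_left _ _)⟩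
      exact ⟨fun x hx => h3 x (hball₁ hx), (h4.mono hball₁).weaken (le_max_left _ _)⟩
    · obtain ⟨h3, h4⟩ := h₂ (-t)
        ⟨by linarith, by linarith [ht.1, min_le_right T₁ T₂]⟩
      simp only [mem_ofPred_eq, neg_neg] at h3 h4
      exact ⟨fun x hx => h3 x (hball₂ hx), (h4.mono hball₂).weaken (le_max_right _ _)⟩
  refine ⟨min r₁ r₂, by positivity, min T₁ T₂, by positivity,
    fun x hx t ht => (key t ht).1 x hx, ?_⟩
  exact continuousOn_prod_of_continuousOn_lipschitzOnWith _ (max L₁ L₂)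
    (fun x hx => (hF x).1.cont.mono fun t ht => (key t ht).1 x hx) fun t ht => (key t ht).2

theorem eventually_mem_and_continuousAt (hF : IsMaximalFlow X I F) (hM : LocallyComplete M)
    (hX : IsArcField X) (hE1 : CondE1 X) (hE2 : CondE2 X) (x : M) :
    I x ⊆ {t | ∀ᶠ p in 𝓝 (x, t), p.2 ∈ I p.1 ∧
      ContinuousAt (fun p : M × ℝ => F p.1 p.2) p} := by
  refine IsPreconnected.subset_of_closure_inter_subset (hF x).1.ordConnected.isPreconnected
    (isOpen_setOfPred_eventually_nhds.preimage (Continuous.prodMk_right x))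
    ⟨0, (hF x).1.zero_mem, ?_⟩ ?_
  · obtain ⟨r, hr, T, hT, hI, hc⟩ := hF.exists_local_continuousOn hM hX hE1 hE2 x
    have hopen : IsOpen (ball x r ×ˢ Ioo (-T) T) := isOpen_ball.prod isOpen_Ioo
    filter_upwards [hopen.mem_nhds (x := (x, (0 : ℝ)))
      ⟨mem_ball_self hr, neg_lt_zero.2 hT, hT⟩] with p hp
    exact ⟨hI _ hp.1 _ hp.2, hc.continuousAt (hopen.mem_nhds hp)⟩
  · rintro t ⟨ht, htI⟩
    obtain ⟨r, hr, T, hT, hI, hc⟩ := hF.exists_local_continuousOn hM hX hE1 hE2 (F x t)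
    have hopen : IsOpen (ball (F x t) r ×ˢ Ioo (-T) T) := isOpen_ball.prod isOpen_Ioo
    have hnear : ∀ᶠ s in 𝓝 t, F x s ∈ ball (F x t) r ∧ s ∈ Ioo (t - T) (t + T) :=
      (((hF x).1.cont.continuousAt ((hF x).1.isOpen.mem_nhds htI)).eventually_mem
        (ball_mem_nhds _ hr)).and (Ioo_mem_nhds (by linarith) (by linarith))
    obtain ⟨s, ⟨hsball, hsT⟩, hs⟩ := mem_closure_iff_nhds.1 ht _ hnear
    have hproj : ∀ p : M × ℝ, Tendsto (fun p : M × ℝ => (p.1, s)) (𝓝 p) (𝓝 (p.1, s)) := fun p =>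
      Continuous.tendsto (by fun_prop) p
    have hgood : ∀ᶠ p : M × ℝ in 𝓝 (x, t), (s ∈ I p.1 ∧
        ContinuousAt (fun p : M × ℝ => F p.1 p.2) (p.1, s)) ∧ F p.1 s ∈ ball (F x t) r ∧
        p.2 - s ∈ Ioo (-T) T := by
      refine ((hproj (x, t)).eventually hs).and (Eventually.and ?_ ?_)
      · exact (Tendsto.comp hs.self_of_nhds.2.tendsto (hproj (x, t))).eventually_mem
          (isOpen_ball.mem_nhds hsball)
      · have : Tendsto (fun p : M × ℝ => p.2 - s) (𝓝 (x, t)) (𝓝 (t - s)) :=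
          Continuous.tendsto (by fun_prop) (x, t)
        exact this.eventually_mem (Ioo_mem_nhds (by linarith [hsT.2]) (by linarith [hsT.1]))
    filter_upwards [hgood.eventually_nhds] with p hp
    have hadd : ∀ᶠ q : M × ℝ in 𝓝 p, q.2 ∈ I q.1 ∧ F q.1 q.2 = F (F q.1 s) (q.2 - s) := by
      filter_upwards [hp] with q hq
      simpa using hF.add hq.1.1 (hI _ hq.2.1 _ hq.2.2)
    obtain ⟨⟨-, hcont⟩, hpball, hpT⟩ := hp.self_of_nhds
    refine ⟨hadd.self_of_nhds.1, ?_⟩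
    have h1 : ContinuousAt (fun q : M × ℝ => F q.1 s) p :=
      Tendsto.comp hcont.tendsto (hproj p)
    have h2 : ContinuousAt (fun q : M × ℝ => (F q.1 s, q.2 - s)) p :=
      h1.prodMk (by fun_prop)
    have h3 : ContinuousAt (fun q : M × ℝ => F q.1 q.2) (F p.1 s, p.2 - s) :=
      hc.continuousAt (hopen.mem_nhds ⟨hpball, hpT⟩)
    refine ContinuousAt.congr (ContinuousAt.comp (f := fun q : M × ℝ => (F q.1 s, q.2 - s))
      h3 h2) ?_
    filter_upwards [hadd] with q hq using hq.2.symm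

end IsMaximalFlow

/-- the domain `W` of the local flow of an arc field satisfying E1
and E2 on a locally complete metric space is open, and the flow is continuous on it. -/
theorem flow_domain_isOpen_and_flow_continuous
    {M : Type*} [MetricSpace M] (hM : LocallyComplete M)
    (X : M → ℝ → M) (hX : IsArcField X) (hE1 : CondE1 X) (hE2 : CondE2 X)
    (I : M → Set ℝ) (F : M → ℝ → M)
    (hF : ∀ x : M, IsSolutionCurve X (I x) (F x) x ∧
      ∀ (J : Set ℝ) (τ : ℝ → M), IsSolutionCurve X J τ x →
        J ⊆ I x ∧ Set.EqOn τ (F x) J) :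
    IsOpen {p : M × ℝ | p.2 ∈ I p.1} ∧
      ContinuousOn (fun p : M × ℝ => F p.1 p.2) {p : M × ℝ | p.2 ∈ I p.1} := by
  have hflow : IsMaximalFlow X I F := hF
  have key := fun x => hflow.eventually_mem_and_continuousAt hM hX hE1 hE2 x
  refine ⟨isOpen_iff_mem_nhds.2 fun p hp => ?_, fun p hp => ?_⟩
  · filter_upwards [key p.1 hp] with q hq using hq.1
  · exact (key p.1 hp).self_of_nhds.2.continuousWithinAt
end

section
/- Let M be a complete metric space and X an arc field on M satisfying Conditions E1 and E2 that has linear speed growth. Then the flow of X is a full flow: for every x ∈ M the maximal solution curve σ_x is defined on all of ℝ, i.e., the flow F(x,t) := σ_x(t) has domain W = M × ℝ. -/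
open Metric Set Asymptotics

variable {M : Type*} [MetricSpace M]

open Filter Topology

/-- Uniform E1, E2 and speed bounds on the ball of radius `R` around `x₀` for times up to `τ`,
with `τ` small relative to the constants. -/
structure LocalBounds (X : M → ℝ → M) (x₀ : M) (R τ Λ Ω K : ℝ) : Prop where
  R_pos : 0 < R
  τ_pos : 0 < τ
  τ_le_one : τ ≤ 1
  Λ_pos : 0 < Λ
  Ω_pos : 0 < Ω
  K_pos : 0 < K
  Λ_mul_τ : Λ * τ ≤ 1 / 2
  K_mul_τ : K * τ ≤ R / 4
  e1 : ∀ y ∈ ball x₀ R, ∀ z ∈ ball x₀ R, ∀ t : ℝ, |t| ≤ τ →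
    dist (X y t) (X z t) ≤ dist y z * (1 + |t| * Λ)
  e2 : ∀ y ∈ ball x₀ R, ∀ s t : ℝ, |s| ≤ τ → |t| ≤ τ →
    dist (X y (s + t)) (X (X y s) t) ≤ |s * t| * Ω
  speed : ∀ y ∈ ball x₀ R, ∀ t : ℝ, |t| ≤ τ → dist (X y t) y ≤ K * |t|

lemma IsArcField.tendsto_apply {X : M → ℝ → M} (hX : IsArcField X) {s : ℝ}
    {p : ℕ → M} {y : M} {u : ℕ → ℝ}
    (hu : ∀ n, |u n| ≤ 1) (hp : Tendsto p atTop (𝓝 y)) (hus : Tendsto u atTop (𝓝 s)) :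
    Tendsto (fun n => X (p n) (u n)) atTop (𝓝 (X y s)) := by
  have hs : |s| ≤ 1 := le_of_tendsto' hus.abs hu
  have hc := hX.1 (y, s) ⟨mem_univ _, abs_le.1 hs⟩
  exact hc.tendsto.comp (tendsto_nhdsWithin_iff.2
    ⟨hp.prodMk_nhds hus, Eventually.of_forall fun n => ⟨mem_univ _, abs_le.1 (hu n)⟩⟩)

lemma exists_localBounds {X : M → ℝ → M} (hX : IsArcField X) (hE1 : CondE1 X)
    (hE2 : CondE2 X) (x₀ : M) : ∃ R τ Λ Ω K : ℝ, LocalBounds X x₀ R τ Λ Ω K := by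
  obtain ⟨r₁, hr₁, δ₁, hδ₁, Λ, hΛ, h1⟩ := hE1 x₀
  obtain ⟨r₂, hr₂, δ₂, hδ₂, Ω, hΩ, h2⟩ := hE2 x₀
  obtain ⟨r₃, hr₃, K, hK, h3⟩ := hX.2.2 x₀
  have hR : 0 < min r₁ (min r₂ r₃) := by positivity
  set R := min r₁ (min r₂ r₃) with hRdef
  obtain ⟨τ, hτ, hτm⟩ := exists_between
    (show 0 < min (min δ₁ δ₂) (min 1 (min (1 / 2 / Λ) (R / 4 / K))) by positivity)
  simp only [lt_min_iff, lt_div_iff₀ hΛ, lt_div_iff₀ hK] at hτm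
  obtain ⟨⟨hτ1, hτ2⟩, hτ3, hτ4, hτ5⟩ := hτm
  have hb : ∀ y ∈ ball x₀ R, y ∈ ball x₀ r₁ ∧ y ∈ ball x₀ r₂ ∧ y ∈ ball x₀ r₃ := by
    intro y hy
    simpa [hRdef, mem_ball] using hy
  refine ⟨R, τ, Λ, Ω, K, hR, hτ, hτ3.le, hΛ, hΩ, hK, by linarith, by linarith, ?_, ?_, ?_⟩
  · exact fun y hy z hz t ht => h1 y (hb y hy).1 z (hb z hz).1 t (ht.trans_lt hτ1)
  · exact fun y hy s t hs ht => h2 y (hb y hy).2.1 s t (hs.trans_lt hτ2) (ht.trans_lt hτ2)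
  · intro y hy t ht
    have := h3 y (hb y hy).2.2 t (abs_le.1 (ht.trans hτ3.le)) 0 (by norm_num)
    rwa [hX.2.1, sub_zero] at this

/-- The `i`-th Euler iterate of step `h` started at `x`. -/
def eulerIter {α : Type*} (X : α → ℝ → α) (x : α) (h : ℝ) (i : ℕ) : α := (fun y => X y h)^[i] x

lemma eulerIter_zero {α : Type*} (X : α → ℝ → α) (x : α) (h : ℝ) : eulerIter X x h 0 = x := rfl

lemma eulerIter_succ {α : Type*} (X : α → ℝ → α) (x : α) (h : ℝ) (i : ℕ) :
    eulerIter X x h (i + 1) = X (eulerIter X x h i) h :=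
  Function.iterate_succ_apply' _ _ _

namespace LocalBounds

variable {X : M → ℝ → M} {x₀ x : M} {R τ Λ Ω K h : ℝ}

lemma apply_zero (B : LocalBounds X x₀ R τ Λ Ω K) {y : M} (hy : y ∈ ball x₀ R) :
    X y 0 = y := by
  have := B.speed y hy 0 (by simpa using B.τ_pos.le)
  simpa using this

lemma apply_mem (B : LocalBounds X x₀ R τ Λ Ω K) {y : M} (hy : dist y x₀ < 3 * R / 4) {t : ℝ}
    (ht : |t| ≤ τ) : X y t ∈ ball x₀ R := by
  have hyR : y ∈ ball x₀ R := by rw [mem_ball]; linarith [B.R_pos]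
  have h1 := B.speed y hyR t ht
  have h2 : K * |t| ≤ K * τ := by have := B.K_pos; gcongr
  have h3 := B.K_mul_τ
  have h4 := dist_triangle (X y t) y x₀
  rw [mem_ball]; linarith

lemma dist_eulerIter_le (B : LocalBounds X x₀ R τ Λ Ω K) (hx : dist x x₀ < R / 2) (hh : 0 ≤ h)
    (i : ℕ) (hi : i * h ≤ τ) : dist (eulerIter X x h i) x ≤ K * (i * h) := by
  induction i with
  | zero => simp [eulerIter_zero]
  | succ i ih =>
    push_cast at hi ⊢
    have hih : 0 ≤ i * h := by positivity
    have h1 := ih (by linarith)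
    have h2 : K * (i * h) ≤ K * τ := by
      have := B.K_pos
      gcongr
      linarith
    have h3 := B.K_mul_τ
    have h4 := dist_triangle (eulerIter X x h i) x x₀
    have h5 := B.speed (eulerIter X x h i) (by rw [mem_ball]; linarith [B.R_pos]) h
      (by rw [abs_of_nonneg hh]; linarith)
    rw [abs_of_nonneg hh] at h5
    rw [eulerIter_succ]
    have h6 := dist_triangle (X (eulerIter X x h i) h) (eulerIter X x h i) x
    linarith

lemma eulerIter_near (B : LocalBounds X x₀ R τ Λ Ω K) (hx : dist x x₀ < R / 2) (hh : 0 ≤ h)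
    {i : ℕ} (hi : i * h ≤ τ) : dist (eulerIter X x h i) x₀ < 3 * R / 4 := by
  have h1 := B.dist_eulerIter_le hx hh i hi
  have h2 : K * (i * h) ≤ K * τ := by have := B.K_pos; gcongr
  have h3 := B.K_mul_τ
  have h4 := dist_triangle (eulerIter X x h i) x x₀
  linarith

lemma eulerIter_mem (B : LocalBounds X x₀ R τ Λ Ω K) (hx : dist x x₀ < R / 2) (hh : 0 ≤ h)
    {i : ℕ} (hi : i * h ≤ τ) : eulerIter X x h i ∈ ball x₀ R := by
  have := B.eulerIter_near hx hh hi
  rw [mem_ball]; linarith [B.R_pos]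

lemma dist_eulerIter_add (B : LocalBounds X x₀ R τ Λ Ω K) (hx : dist x x₀ < R / 2) (hh : 0 ≤ h)
    (i k : ℕ) (hi : (i + k : ℕ) * h ≤ τ) :
    dist (eulerIter X x h (i + k)) (X (eulerIter X x h i) (k * h)) ≤ Ω * (k * h) ^ 2 := by
  induction k with
  | zero =>
    rw [add_zero] at hi
    simp [B.apply_zero (B.eulerIter_mem hx hh hi)]
  | succ k ih =>
    push_cast at hi ih ⊢
    have hih : 0 ≤ i * h := by positivity
    have hkh : 0 ≤ k * h := by positivity
    have hyn := B.eulerIter_near hx hh (i := i) (by linarith)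
    have hy := B.eulerIter_mem hx hh (i := i) (by linarith)
    have hz := B.eulerIter_mem hx hh (i := i + k) (by push_cast; linarith)
    have hw := B.apply_mem hyn (t := k * h) (by rw [abs_of_nonneg hkh]; linarith)
    have h1 := ih (by linarith)
    have h2 := B.e1 _ hz _ hw h (by rw [abs_of_nonneg hh]; linarith)
    have h3 := B.e2 _ hy (k * h) h (by rw [abs_of_nonneg hkh]; linarith)
      (by rw [abs_of_nonneg hh]; linarith)
    rw [abs_of_nonneg hh] at h2
    rw [abs_of_nonneg (mul_nonneg hkh hh)] at h3
    rw [← add_assoc, eulerIter_succ, add_mul, one_mul]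
    have h4 := dist_triangle_right (X (eulerIter X x h (i + k)) h)
      (X (eulerIter X x h i) (k * h + h)) (X (X (eulerIter X x h i) (k * h)) h)
    have h5 := mul_le_mul_of_nonneg_right h1
      (show 0 ≤ 1 + h * Λ by have := B.Λ_pos; positivity)
    have h6 : Λ * (k * h) ≤ 1 := by
      have := mul_le_mul_of_nonneg_left (show k * h ≤ τ by linarith) B.Λ_pos.le
      linarith [B.Λ_mul_τ]
    have h7 := mul_le_mul_of_nonneg_left h6
      (show 0 ≤ Ω * (k * h) * h by have := B.Ω_pos; positivity)
    have h8 : 0 ≤ Ω * h ^ 2 := by have := B.Ω_pos; positivity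
    nlinarith

lemma dist_eulerIter_half (B : LocalBounds X x₀ R τ Λ Ω K) (hx : dist x x₀ < R / 2) (hh : 0 ≤ h)
    (i : ℕ) (hi : i * h ≤ τ) :
    dist (eulerIter X x h i) (eulerIter X x (h / 2) (2 * i)) ≤ Ω * i * h ^ 2 := by
  induction i with
  | zero => simp [eulerIter_zero]
  | succ i ih =>
    push_cast at hi ⊢
    have hih : 0 ≤ i * h := by positivity
    have hh2 : 0 ≤ h / 2 := by positivity
    have hy := B.eulerIter_mem hx hh (i := i) (by linarith)
    have hz := B.eulerIter_mem hx hh2 (i := 2 * i) (by push_cast; linarith)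
    have h1 := ih (by linarith)
    have h2 := B.e1 _ hy _ hz h (by rw [abs_of_nonneg hh]; linarith)
    have h3 := B.e2 _ hz (h / 2) (h / 2) (by rw [abs_of_nonneg hh2]; linarith)
      (by rw [abs_of_nonneg hh2]; linarith)
    rw [abs_of_nonneg hh] at h2
    rw [abs_of_nonneg (mul_nonneg hh2 hh2), add_halves] at h3
    rw [show 2 * (i + 1) = 2 * i + 1 + 1 by ring, eulerIter_succ, eulerIter_succ, eulerIter_succ]
    have h4 := dist_triangle (X (eulerIter X x h i) h) (X (eulerIter X x (h / 2) (2 * i)) h)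
      (X (X (eulerIter X x (h / 2) (2 * i)) (h / 2)) (h / 2))
    have h5 := mul_le_mul_of_nonneg_right h1
      (show 0 ≤ 1 + h * Λ by have := B.Λ_pos; positivity)
    have h6 : Λ * (i * h) ≤ 1 / 2 := by
      have := mul_le_mul_of_nonneg_left (show i * h ≤ τ by linarith) B.Λ_pos.le
      linarith [B.Λ_mul_τ]
    have h8 : 0 ≤ Ω * h ^ 2 := by have := B.Ω_pos; positivity
    have h7 := mul_le_mul_of_nonneg_left h6 h8
    nlinarith

lemma dist_eulerApprox_succ (B : LocalBounds X x₀ R τ Λ Ω K) (hx : dist x x₀ < R / 2) {a : ℝ}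
    (ha : a ∈ Icc (0 : ℝ) 1) (n : ℕ) :
    dist (eulerIter X x (τ / 2 ^ n) ⌊a * 2 ^ n⌋₊)
      (eulerIter X x (τ / 2 ^ (n + 1)) ⌊a * 2 ^ (n + 1)⌋₊) ≤
      (Ω * τ ^ 2 + K * τ) * (1 / 2) ^ n := by
  have hτ := B.τ_pos
  have hΩ := B.Ω_pos
  have hK := B.K_pos
  have h2n : (0 : ℝ) < 2 ^ n := by positivity
  have ha0 : 0 ≤ a * 2 ^ n := mul_nonneg ha.1 h2n.le
  have hh : 0 ≤ τ / 2 ^ n := by positivity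
  have hhalf : τ / 2 ^ (n + 1) = τ / 2 ^ n / 2 := by rw [pow_succ, div_div]
  have e1 : a * 2 ^ (n + 1) = 2 * (a * 2 ^ n) := by ring
  have hle : ∀ m : ℕ, (⌊a * 2 ^ m⌋₊ : ℝ) * (τ / 2 ^ m) ≤ τ := by
    intro m
    have h1 : (⌊a * 2 ^ m⌋₊ : ℝ) ≤ a * 2 ^ m := Nat.floor_le (mul_nonneg ha.1 (by positivity))
    have h2 : a * 2 ^ m ≤ 2 ^ m := mul_le_of_le_one_left (by positivity) ha.2
    calc (⌊a * 2 ^ m⌋₊ : ℝ) * (τ / 2 ^ m) ≤ 2 ^ m * (τ / 2 ^ m) := by gcongr; linarith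
      _ = τ := by field_simp
  have hl := hle n
  have hl' := hle (n + 1)
  have hf1 : (⌊a * 2 ^ n⌋₊ : ℝ) ≤ a * 2 ^ n := Nat.floor_le ha0
  have hf2 := Nat.lt_floor_add_one (a * 2 ^ n)
  have hcase : ⌊a * 2 ^ (n + 1)⌋₊ = 2 * ⌊a * 2 ^ n⌋₊ ∨
      ⌊a * 2 ^ (n + 1)⌋₊ = 2 * ⌊a * 2 ^ n⌋₊ + 1 := by
    have g1 : 2 * ⌊a * 2 ^ n⌋₊ ≤ ⌊a * 2 ^ (n + 1)⌋₊ :=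
      Nat.le_floor (by push_cast; rw [e1]; linarith)
    have g2 : ⌊a * 2 ^ (n + 1)⌋₊ < 2 * ⌊a * 2 ^ n⌋₊ + 2 :=
      (Nat.floor_lt (by rw [e1]; linarith)).2 (by push_cast; rw [e1]; linarith)
    omega
  have hmain := B.dist_eulerIter_half hx hh _ hl
  set i := ⌊a * 2 ^ n⌋₊
  set h := τ / 2 ^ n with hdef
  have hb1 : Ω * i * h ^ 2 ≤ Ω * τ * h := by
    have := mul_le_mul_of_nonneg_left hl (show 0 ≤ Ω * h by positivity)
    nlinarith
  have hb2 : (Ω * τ ^ 2 + K * τ) * (1 / 2) ^ n = Ω * τ * h + K * h := by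
    rw [hdef, one_div, inv_pow]; ring
  rw [hb2, hhalf]
  rcases hcase with hc | hc
  · rw [hc]
    have : 0 ≤ K * h := by positivity
    linarith
  · rw [hc, hhalf] at hl'
    rw [hc, eulerIter_succ]
    push_cast at hl'
    have hz := B.eulerIter_mem hx (h := h / 2) (by positivity) (i := 2 * i)
      (by push_cast; linarith)
    have hi0 : 0 ≤ i * h := by positivity
    have h5 := B.speed _ hz (h / 2) (by rw [abs_of_nonneg (by positivity)]; linarith)
    rw [abs_of_nonneg (by positivity)] at h5
    have h6 := dist_triangle_right (eulerIter X x h i) (X (eulerIter X x (h / 2) (2 * i)) (h / 2))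
      (eulerIter X x (h / 2) (2 * i))
    have : 0 ≤ K * h := by positivity
    linarith

/-- Local existence, with a quadratic tangency estimate. -/
lemma exists_curve [CompleteSpace M] (hX : IsArcField X) (B : LocalBounds X x₀ R τ Λ Ω K)
    (hx : dist x x₀ < R / 2) :
    ∃ σ : ℝ → M, σ 0 = x ∧ ∀ t ∈ Icc 0 τ, ∀ s ∈ Icc 0 τ,
      dist (σ s) (X (σ t) (s - t)) ≤ 3 * Ω * (s - t) ^ 2 := by
  have hτ := B.τ_pos
  have hΩ := B.Ω_pos
  have hlim : ∀ t ∈ Icc 0 τ, ∃ y, Tendsto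
      (fun n : ℕ => eulerIter X x (τ / 2 ^ n) ⌊t / τ * 2 ^ n⌋₊) atTop (𝓝 y) := by
    intro t ht
    have ha : t / τ ∈ Icc (0 : ℝ) 1 := ⟨div_nonneg ht.1 hτ.le, (div_le_one hτ).2 ht.2⟩
    exact cauchySeq_tendsto_of_complete (cauchySeq_of_le_geometric (1 / 2) _ (by norm_num)
      (B.dist_eulerApprox_succ hx ha))
  have : Nonempty M := ⟨x⟩
  choose! σ hσ using hlim
  have hgrid : ∀ t ∈ Icc 0 τ, ∀ n : ℕ, (⌊t / τ * 2 ^ n⌋₊ : ℝ) * (τ / 2 ^ n) ≤ t := by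
    intro t ht n
    have h1 : (⌊t / τ * 2 ^ n⌋₊ : ℝ) ≤ t / τ * 2 ^ n :=
      Nat.floor_le (mul_nonneg (div_nonneg ht.1 hτ.le) (by positivity))
    calc (⌊t / τ * 2 ^ n⌋₊ : ℝ) * (τ / 2 ^ n) ≤ t / τ * 2 ^ n * (τ / 2 ^ n) := by gcongr
      _ = t := by field_simp
  have hgridlim : ∀ t ∈ Icc 0 τ, Tendsto
      (fun n : ℕ => (⌊t / τ * 2 ^ n⌋₊ : ℝ) * (τ / 2 ^ n)) atTop (𝓝 t) := by
    intro t ht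
    have h1 := ((tendsto_nat_floor_mul_div_atTop (div_nonneg ht.1 hτ.le)).comp
      (tendsto_pow_atTop_atTop_of_one_lt (one_lt_two (α := ℝ)))).mul_const τ
    rw [div_mul_cancel₀ t hτ.ne'] at h1
    exact h1.congr fun n => by simp only [Function.comp]; ring
  have hnear' : ∀ t ∈ Icc 0 τ, dist (σ t) x₀ < 3 * R / 4 := by
    intro t ht
    have h1 : dist (σ t) x ≤ R / 4 :=
      le_of_tendsto' ((hσ t ht).dist tendsto_const_nhds) fun n => by
        refine (B.dist_eulerIter_le hx (by positivity) _ ((hgrid t ht n).trans ht.2)).trans ?_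
        exact (mul_le_mul_of_nonneg_left ((hgrid t ht n).trans ht.2) B.K_pos.le).trans B.K_mul_τ
    linarith [dist_triangle (σ t) x x₀]
  have hnear : ∀ t ∈ Icc 0 τ, σ t ∈ ball x₀ R := fun t ht => by
    rw [mem_ball]; linarith [B.R_pos, hnear' t ht]
  have hfwd : ∀ t ∈ Icc 0 τ, ∀ s ∈ Icc 0 τ, t ≤ s →
      dist (σ s) (X (σ t) (s - t)) ≤ Ω * (s - t) ^ 2 := by
    intro t ht s hs hts
    have hmono : ∀ n : ℕ, ⌊t / τ * 2 ^ n⌋₊ ≤ ⌊s / τ * 2 ^ n⌋₊ := fun n =>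
      Nat.floor_mono (by gcongr)
    have hu := (hgridlim s hs).sub (hgridlim t ht)
    refine le_of_tendsto_of_tendsto' ((hσ s hs).dist (hX.tendsto_apply ?_ (hσ t ht) hu))
      ((hu.pow 2).const_mul Ω) fun n => ?_
    · intro n
      have h1 := hgrid s hs n
      have h2 := hgrid t ht n
      have h3 : (0 : ℝ) ≤ ⌊s / τ * 2 ^ n⌋₊ * (τ / 2 ^ n) := by positivity
      have h4 : (0 : ℝ) ≤ ⌊t / τ * 2 ^ n⌋₊ * (τ / 2 ^ n) := by positivity
      have h5 := B.τ_le_one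
      rw [abs_le]
      constructor <;> linarith [ht.2, hs.2]
    · have h1 := B.dist_eulerIter_add hx (h := τ / 2 ^ n) (by positivity) ⌊t / τ * 2 ^ n⌋₊
        (⌊s / τ * 2 ^ n⌋₊ - ⌊t / τ * 2 ^ n⌋₊)
        (by rw [Nat.add_sub_cancel' (hmono n)]; exact (hgrid s hs n).trans hs.2)
      rw [Nat.add_sub_cancel' (hmono n), Nat.cast_sub (hmono n), sub_mul] at h1
      exact h1
  refine ⟨σ, ?_, ?_⟩
  · have h0 := hσ 0 ⟨le_rfl, hτ.le⟩
    simp only [zero_div, zero_mul, Nat.floor_zero, eulerIter_zero] at h0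
    exact tendsto_nhds_unique h0 tendsto_const_nhds
  · intro t ht s hs
    rcases le_total t s with hts | hst
    · have := hfwd t ht s hs hts
      have : 0 ≤ Ω * (s - t) ^ 2 := by positivity
      linarith
    · have h1 := hfwd s hs t ht hst
      have habs : |t - s| ≤ τ := by
        rw [abs_of_nonneg (by linarith)]; linarith [ht.2, hs.1]
      have habs' : |s - t| ≤ τ := by rwa [abs_sub_comm]
      have h2 := B.e2 _ (hnear s hs) (t - s) (s - t) habs habs'
      have h3 := B.e1 _ (hnear t ht) _ (B.apply_mem (hnear' s hs) habs) (s - t) habs'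
      rw [show t - s + (s - t) = 0 by ring, B.apply_zero (hnear s hs),
        show |(t - s) * (s - t)| = (s - t) ^ 2 by
          rw [abs_mul, abs_sub_comm, abs_mul_abs_self, sq]] at h2
      have h4 := dist_triangle_right (σ s) (X (σ t) (s - t)) (X (X (σ s) (t - s)) (s - t))
      have h5 : 1 + |s - t| * Λ ≤ 2 := by
        have := mul_le_mul_of_nonneg_right habs' B.Λ_pos.le
        linarith [B.Λ_mul_τ]
      have h6 := mul_le_mul h1 h5
        (add_nonneg zero_le_one (mul_nonneg (abs_nonneg _) B.Λ_pos.le)) (by positivity)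
      nlinarith

end LocalBounds

/-- The curve `σ` is tangent to `X` along `S`: at each `t ∈ S`, `σ s` and `X (σ t) (s - t)` agree
to first order as `s → t` within `S`. -/
def TangentOn (X : M → ℝ → M) (σ : ℝ → M) (S : Set ℝ) : Prop :=
  ∀ t ∈ S, (fun s => dist (σ s) (X (σ t) (s - t))) =o[𝓝[S] t] fun s => s - t

namespace TangentOn

variable {X : M → ℝ → M} {σ σ' : ℝ → M} {S S' : Set ℝ}

lemma mono (h : TangentOn X σ S) (hS : S' ⊆ S) : TangentOn X σ S' :=
  fun t ht => (h t (hS ht)).mono (nhdsWithin_mono t hS)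

lemma congr (h : TangentOn X σ S) (hσ : EqOn σ' σ S) : TangentOn X σ' S := by
  intro t ht
  refine (h t ht).congr' ?_ EventuallyEq.rfl
  filter_upwards [self_mem_nhdsWithin] with s hs
  rw [hσ hs, hσ ht]

lemma union (h : TangentOn X σ S) (h' : TangentOn X σ S') (hS : IsClosed S)
    (hS' : IsClosed S') : TangentOn X σ (S ∪ S') := by
  have key : ∀ A : Set ℝ, IsClosed A → TangentOn X σ A → ∀ t,
      (fun s => dist (σ s) (X (σ t) (s - t))) =o[𝓝[A] t] fun s => s - t := by
    intro A hA hT t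
    by_cases ht : t ∈ A
    · exact hT t ht
    · rw [← hA.closure_eq, notMem_closure_iff_nhdsWithin_eq_bot] at ht
      rw [ht]
      exact IsLittleO.of_bound fun _ _ => eventually_bot
  intro t _
  rw [nhdsWithin_union]
  exact (key S hS h t).sup (key S' hS' h' t)

lemma comp_sub_const (h : TangentOn X σ S) (T : ℝ) :
    TangentOn X (fun s => σ (s - T)) ((fun s => s - T) ⁻¹' S) := by
  intro t ht
  have hk : Tendsto (fun s => s - T) (𝓝[(fun s => s - T) ⁻¹' S] t) (𝓝[S] (t - T)) :=
    (continuous_id.sub continuous_const).continuousWithinAt.tendsto_nhdsWithin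
      (mapsTo_preimage _ S)
  refine ((h (t - T) ht).comp_tendsto hk).congr (fun s => ?_) fun s => ?_ <;>
    simp [Function.comp]

lemma comp_neg (h : TangentOn (fun y t => X y (-t)) σ S) :
    TangentOn X (fun s => σ (-s)) ((fun s => -s) ⁻¹' S) := by
  intro t ht
  have hk : Tendsto (fun s : ℝ => -s) (𝓝[(fun s => -s) ⁻¹' S] t) (𝓝[S] (-t)) :=
    continuous_neg.continuousWithinAt.tendsto_nhdsWithin (mapsTo_preimage _ S)
  refine (IsLittleO.neg_right ((h (-t) ht).comp_tendsto hk)).congr (fun s => ?_) fun s => ?_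
  · simp only [Function.comp]
    congr 2
    ring
  · simp only [Function.comp]
    ring

lemma of_quadratic {C : ℝ}
    (h : ∀ t ∈ S, ∀ s ∈ S, dist (σ s) (X (σ t) (s - t)) ≤ C * (s - t) ^ 2) :
    TangentOn X σ S := by
  intro t ht
  have h1 : (fun s => dist (σ s) (X (σ t) (s - t))) =O[𝓝[S] t] fun s => (s - t) ^ 2 := by
    refine IsBigO.of_bound C ?_
    filter_upwards [self_mem_nhdsWithin] with s hs
    rw [Real.norm_of_nonneg dist_nonneg, Real.norm_of_nonneg (sq_nonneg _)]
    exact h t ht s hs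
  have h2 : (fun s => (s - t) ^ 2) =o[𝓝 t] fun s => s - t := by
    have := (isLittleO_pow_id (𝕜 := ℝ) one_lt_two).comp_tendsto
      (show Tendsto (fun s => s - t) (𝓝 t) (𝓝 0) by
        simpa using (continuous_sub_right t).tendsto t)
    exact this
  exact h1.trans_isLittleO (h2.mono nhdsWithin_le_nhds)

lemma continuousOn (hX : IsArcField X) (h : TangentOn X σ S) : ContinuousOn σ S := by
  intro t ht
  have h0 : Tendsto (fun s => s - t) (𝓝[S] t) (𝓝 0) := by
    simpa using ((continuous_sub_right t).tendsto t).mono_left nhdsWithin_le_nhds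
  have h1 := (h t ht).trans_tendsto h0
  obtain ⟨r, hr, K, -, hK⟩ := hX.2.2 (σ t)
  have h2 : ∀ᶠ s in 𝓝[S] t, dist (σ s) (σ t) ≤ dist (σ s) (X (σ t) (s - t)) + K * |s - t| := by
    filter_upwards [h0 (Icc_mem_nhds (a := -1) (b := 1) (by norm_num) (by norm_num))] with s hs
    have := hK (σ t) (mem_ball_self hr) (s - t) hs 0 (by norm_num)
    rw [hX.2.1, sub_zero] at this
    linarith [dist_triangle (σ s) (X (σ t) (s - t)) (σ t)]
  refine tendsto_iff_dist_tendsto_zero.2 (squeeze_zero' (Eventually.of_forall fun _ => dist_nonneg)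
    h2 ?_)
  simpa using h1.add (h0.abs.const_mul K)

lemma dist_le_gronwallBound (hX : IsArcField X) {a b K ε : ℝ} {q : M}
    (h : TangentOn X σ (Icc a b))
    (hs : ∀ t ∈ Ico a b, ∀ u ∈ Icc (-1 : ℝ) 1,
      dist (X (σ t) u) (σ t) ≤ (K * dist (σ t) q + ε) * |u|) {t : ℝ} (ht : t ∈ Icc a b) :
    dist (σ t) q ≤ gronwallBound (dist (σ a) q) K ε (t - a) := by
  refine le_gronwallBound_of_liminf_deriv_right_le (f := fun t => dist (σ t) q)
    (f' := fun t => K * dist (σ t) q + ε)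
    (fun s hs => Tendsto.dist (h.continuousOn hX s hs) tendsto_const_nhds)
    ?_ le_rfl (fun _ _ => le_rfl) t ht
  intro t ht r hr
  refine Eventually.frequently ?_
  have hlo : (fun s => dist (σ s) (X (σ t) (s - t))) =o[𝓝[>] t] fun s => s - t := by
    refine (h t (Ico_subset_Icc_self ht)).mono ?_
    rw [← nhdsWithin_Ioc_eq_nhdsGT ht.2]
    exact nhdsWithin_mono t fun z hz => ⟨ht.1.trans hz.1.le, hz.2⟩
  have hc : 0 < (r - (K * dist (σ t) q + ε)) / 2 := by linarith
  filter_upwards [hlo.bound hc, self_mem_nhdsWithin,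
    Ioc_mem_nhdsGT (show t < t + 1 by linarith)] with z hz hzt hz1
  have hzt' : 0 < z - t := sub_pos.2 hzt
  rw [Real.norm_of_nonneg dist_nonneg, Real.norm_of_nonneg hzt'.le] at hz
  have h1 := hs t ht (z - t) ⟨by linarith, by linarith [hz1.2]⟩
  rw [abs_of_pos hzt'] at h1
  have h2 := dist_triangle (σ z) (σ t) q
  have h3 := dist_triangle (σ z) (X (σ t) (z - t)) (σ t)
  rw [inv_mul_lt_iff₀ hzt']
  nlinarith

end TangentOn

/-- Local existence for a time that is locally bounded away from zero. -/
lemma exists_localFlow [CompleteSpace M] {X : M → ℝ → M} (hX : IsArcField X) (hE1 : CondE1 X)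
    (hE2 : CondE2 X) : ∃ (τ : M → ℝ) (c : M → ℝ → M),
      (∀ y, 0 < τ y ∧ c y 0 = y ∧ TangentOn X (c y) (Icc 0 (τ y))) ∧
      ∀ x₀, ∃ ε > 0, ∀ᶠ y in 𝓝 x₀, ε ≤ τ y := by
  classical
  have hloc : ∀ x₀ : M, ∃ n : ℕ, ∀ᶠ y in 𝓝 x₀, ∃ c : ℝ → M, c 0 = y ∧
      TangentOn X c (Icc 0 (1 / ((n : ℝ) + 1))) := by
    intro x₀
    obtain ⟨R, τ, Λ, Ω, K, B⟩ := exists_localBounds hX hE1 hE2 x₀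
    obtain ⟨n, hn⟩ := exists_nat_one_div_lt B.τ_pos
    refine ⟨n, ?_⟩
    filter_upwards [ball_mem_nhds x₀ (half_pos B.R_pos)] with y hy
    obtain ⟨c, hc0, hc⟩ := B.exists_curve hX hy
    exact ⟨c, hc0, (TangentOn.of_quadratic hc).mono (Icc_subset_Icc_right hn.le)⟩
  have hex : ∀ y : M, ∃ n : ℕ, ∃ c : ℝ → M, c 0 = y ∧
      TangentOn X c (Icc 0 (1 / ((n : ℝ) + 1))) :=
    fun y => (hloc y).imp fun n hn => hn.self_of_nhds
  choose c hc using fun y => Nat.find_spec (hex y)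
  refine ⟨fun y => 1 / ((Nat.find (hex y) : ℝ) + 1), c,
    fun y => ⟨by positivity, hc y⟩, fun x₀ => ?_⟩
  obtain ⟨n, hn⟩ := hloc x₀
  refine ⟨1 / ((n : ℝ) + 1), by positivity, ?_⟩
  filter_upwards [hn] with y hy
  have : (Nat.find (hex y) : ℝ) ≤ n := by exact_mod_cast Nat.find_min' (hex y) hy
  gcongr

/-- Linear speed growth makes curves tangent to `X` Lipschitz on bounded time intervals. -/
lemma LinearSpeedGrowth.exists_lipschitz {X : M → ℝ → M} (hX : IsArcField X)
    (hlin : LinearSpeedGrowth X) (x : M) (b : ℝ) :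
    ∃ L, ∀ (σ : ℝ → M) (T : ℝ), σ 0 = x → T ≤ b → TangentOn X σ (Icc 0 T) →
      ∀ s ∈ Icc 0 T, ∀ t ∈ Icc 0 T, s ≤ t → dist (σ t) (σ s) ≤ L * (t - s) := by
  obtain ⟨p, c₁, hc₁, c₂, hc₂, hsp⟩ := hlin
  have hspeed : ∀ y, ∀ u ∈ Icc (-1 : ℝ) 1,
      dist (X y u) y ≤ (c₁ * dist y p + (c₁ + c₂)) * |u| := by
    intro y u hu
    have := hsp (dist y p + 1) (by positivity) y (by simp [mem_ball]) u hu 0 (by norm_num)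
    rw [hX.2.1, sub_zero] at this
    linarith
  set ρ := gronwallBound (dist x p) c₁ (c₁ + c₂) b
  refine ⟨c₁ * ρ + (c₁ + c₂), fun σ T h0 hT hσ s hs t ht hst => ?_⟩
  have hbd : ∀ t ∈ Icc 0 T, dist (σ t) p ≤ ρ := by
    intro t ht
    have h1 := hσ.dist_le_gronwallBound hX (q := p) (fun t _ => hspeed (σ t)) ht
    rw [h0, sub_zero] at h1
    exact h1.trans (gronwallBound_mono dist_nonneg (by positivity) hc₁.le (ht.2.trans hT))
  have h2 := (hσ.mono (Icc_subset_Icc hs.1 ht.2)).dist_le_gronwallBound hX (q := σ s) (K := 0)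
    (ε := c₁ * ρ + (c₁ + c₂)) (t := t) ?_ ⟨hst, le_rfl⟩
  · simpa [gronwallBound_K0] using h2
  · intro r hr u hu
    refine (hspeed (σ r) u hu).trans ?_
    have := hbd r ⟨hs.1.trans hr.1, hr.2.le.trans ht.2⟩
    rw [zero_mul, zero_add]
    gcongr

/-- Extend the curve `p.2`, considered on times up to `p.1`, by the local solution starting at
its endpoint. -/
noncomputable def extendCurve {α : Type*} (τ : α → ℝ) (c : α → ℝ → α) (p : ℝ × (ℝ → α)) :
    ℝ × (ℝ → α) :=
  (p.1 + τ (p.2 p.1), fun s => if s ≤ p.1 then p.2 s else c (p.2 p.1) (s - p.1))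

lemma tangentOn_extendCurve {X : M → ℝ → M} {τ : M → ℝ} {c : M → ℝ → M}
    (hc : ∀ y, 0 < τ y ∧ c y 0 = y ∧ TangentOn X (c y) (Icc 0 (τ y))) {p : ℝ × (ℝ → M)}
    (hp : 0 ≤ p.1) (h : TangentOn X p.2 (Icc 0 p.1)) :
    TangentOn X (extendCurve τ c p).2 (Icc 0 (extendCurve τ c p).1) := by
  obtain ⟨T, σ⟩ := p
  obtain ⟨hτ, hc0, hct⟩ := hc (σ T)
  simp only [extendCurve] at *
  rw [← Icc_union_Icc_eq_Icc hp (show T ≤ T + τ (σ T) by linarith)]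
  refine TangentOn.union (h.congr fun s hs => if_pos hs.2) ?_ isClosed_Icc isClosed_Icc
  refine ((hct.comp_sub_const T).mono fun s hs => ?_).congr fun s hs => ?_
  · exact ⟨by linarith [hs.1], by linarith [hs.2]⟩
  · rcases hs.1.eq_or_lt with rfl | hlt
    · simp [hc0]
    · exact if_neg hlt.not_ge

lemma exists_forward_curve [CompleteSpace M] {X : M → ℝ → M} (hX : IsArcField X)
    (hE1 : CondE1 X) (hE2 : CondE2 X) (hlin : LinearSpeedGrowth X) (x : M) :
    ∃ σ : ℝ → M, σ 0 = x ∧ TangentOn X σ (Ici 0) := by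
  obtain ⟨τ, c, hc, hτ⟩ := exists_localFlow hX hE1 hE2
  let p : ℕ → ℝ × (ℝ → M) := fun n => (extendCurve τ c)^[n] (0, fun _ => x)
  have hp : ∀ n, p (n + 1) = extendCurve τ c (p n) := fun n =>
    Function.iterate_succ_apply' _ _ _
  have hT1 : ∀ n, (p (n + 1)).1 = (p n).1 + τ ((p n).2 (p n).1) := fun n => by
    rw [hp, extendCurve]
  have hTmono : Monotone fun n => (p n).1 := monotone_nat_of_le_succ fun n => by
    rw [hT1]; linarith [(hc ((p n).2 (p n).1)).1]
  have hT0 : ∀ n, 0 ≤ (p n).1 := fun n => hTmono (Nat.zero_le n)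
  have hagree : ∀ m n, m ≤ n → ∀ s ≤ (p m).1, (p n).2 s = (p m).2 s := by
    intro m n hmn
    induction n, hmn using Nat.le_induction with
    | base => exact fun _ _ => rfl
    | succ n hmn ih =>
      intro s hs
      rw [← ih s hs, hp, extendCurve]
      exact if_pos (hs.trans (hTmono hmn))
  have hinit : ∀ n, (p n).2 0 = x := fun n => hagree 0 n (Nat.zero_le n) 0 le_rfl
  have htan : ∀ n, TangentOn X (p n).2 (Icc 0 (p n).1) := by
    intro n
    induction n with
    | zero =>
      refine TangentOn.of_quadratic (C := 0) fun t ht s hs => ?_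
      rw [le_antisymm ht.2 ht.1, le_antisymm hs.2 hs.1]
      simp [p, hX.2.1]
    | succ n ih =>
      rw [hp]
      exact tangentOn_extendCurve hc (hT0 n) ih
  have hunb : ∀ b : ℝ, ∃ n, b < (p n).1 := by
    intro b
    by_contra! hb
    obtain ⟨L, hL⟩ := hlin.exists_lipschitz hX x b
    have hTc : CauchySeq fun n => (p n).1 :=
      (tendsto_atTop_ciSup hTmono ⟨b, by rintro _ ⟨n, rfl⟩; exact hb n⟩).cauchySeq
    have hdist : ∀ m n, m ≤ n → dist ((p n).2 (p n).1) ((p m).2 (p m).1) ≤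
        |L| * |(p n).1 - (p m).1| := by
      intro m n hmn
      have h1 := hL (p n).2 (p n).1 (hinit n) (hb n) (htan n) (p m).1 ⟨hT0 m, hTmono hmn⟩
        (p n).1 ⟨hT0 n, le_rfl⟩ (hTmono hmn)
      rw [hagree m n hmn _ le_rfl] at h1
      rw [← abs_mul]
      exact h1.trans (le_abs_self _)
    have hyc : CauchySeq fun n => (p n).2 (p n).1 := by
      rw [Metric.cauchySeq_iff'] at hTc ⊢
      intro ε hε
      obtain ⟨N, hN⟩ := hTc (ε / (|L| + 1)) (by positivity)
      refine ⟨N, fun n hn => (hdist N n hn).trans_lt ?_⟩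
      have h1 := hN n hn
      rw [Real.dist_eq, lt_div_iff₀ (by positivity)] at h1
      nlinarith [abs_nonneg ((p n).1 - (p N).1)]
    obtain ⟨y, hy⟩ := cauchySeq_tendsto_of_complete hyc
    obtain ⟨ε, hε, hev⟩ := hτ y
    obtain ⟨N, hN⟩ := Metric.cauchySeq_iff'.1 hTc (ε / 2) (by positivity)
    obtain ⟨n, hn1, hn2⟩ := ((hy.eventually hev).and (eventually_ge_atTop N)).exists
    have h1 := hN (n + 1) (by omega)
    rw [Real.dist_eq, hT1] at h1
    have h2 := (abs_lt.1 h1).2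
    have h3 : (p N).1 ≤ (p n).1 := hTmono hn2
    linarith
  choose! k hk using hunb
  have hσ : ∀ n, ∀ s ≤ (p n).1, (p (k s)).2 s = (p n).2 s := by
    intro n s hs
    rcases le_total (k s) n with h | h
    · exact (hagree _ _ h s (hk s).le).symm
    · exact hagree _ _ h s hs
  refine ⟨fun s => (p (k s)).2 s, hinit _, fun t ht => ?_⟩
  have h1 := (htan (k t)).congr fun s hs => hσ (k t) s hs.2
  have h2 := h1 t ⟨ht, (hk t).le⟩
  rwa [← Ici_inter_Iic, nhdsWithin_inter_of_mem' (mem_nhdsWithin_of_mem_nhds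
    (Iic_mem_nhds (hk t)))] at h2

lemma IsArcField.neg {X : M → ℝ → M} (hX : IsArcField X) :
    IsArcField fun y t => X y (-t) := by
  have hI : ∀ t ∈ Icc (-1 : ℝ) 1, -t ∈ Icc (-1 : ℝ) 1 := fun t ht =>
    ⟨by linarith [ht.2], by linarith [ht.1]⟩
  refine ⟨?_, fun y => by simp [hX.2.1], fun x => ?_⟩
  · exact hX.1.comp (f := fun q : M × ℝ => (q.1, -q.2)) (by fun_prop)
      fun q hq => ⟨mem_univ _, hI _ hq.2⟩
  · obtain ⟨r, hr, K, hK, h⟩ := hX.2.2 x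
    refine ⟨r, hr, K, hK, fun y hy s hs t ht => ?_⟩
    have := h y hy (-s) (hI s hs) (-t) (hI t ht)
    rwa [neg_sub_neg, abs_sub_comm] at this

lemma CondE1.neg {X : M → ℝ → M} (h : CondE1 X) : CondE1 fun y t => X y (-t) := by
  intro x₀
  obtain ⟨r, hr, δ, hδ, Λ, hΛ, h⟩ := h x₀
  exact ⟨r, hr, δ, hδ, Λ, hΛ, fun x hx y hy t ht => by
    simpa using h x hx y hy (-t) (by simpa using ht)⟩

lemma CondE2.neg {X : M → ℝ → M} (h : CondE2 X) : CondE2 fun y t => X y (-t) := by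
  intro x₀
  obtain ⟨r, hr, δ, hδ, Ω, hΩ, h⟩ := h x₀
  refine ⟨r, hr, δ, hδ, Ω, hΩ, fun x hx s t hs ht => ?_⟩
  have := h x hx (-s) (-t) (by simpa using hs) (by simpa using ht)
  rwa [neg_mul_neg, ← neg_add] at this

lemma LinearSpeedGrowth.neg {X : M → ℝ → M} (h : LinearSpeedGrowth X) :
    LinearSpeedGrowth fun y t => X y (-t) := by
  obtain ⟨x, c₁, hc₁, c₂, hc₂, h⟩ := h
  refine ⟨x, c₁, hc₁, c₂, hc₂, fun r hr y hy s hs t ht => ?_⟩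
  have := h r hr y hy (-s) ⟨by linarith [hs.2], by linarith [hs.1]⟩ (-t)
    ⟨by linarith [ht.2], by linarith [ht.1]⟩
  rwa [neg_sub_neg, abs_sub_comm] at this

/-- on a complete metric space, an arc field satisfying E1 and E2
with linear speed growth generates a full flow: every maximal solution curve is
defined on all of `ℝ`. -/
theorem fullFlow_of_linearSpeedGrowth
    {M : Type*} [MetricSpace M] [CompleteSpace M]
    (X : M → ℝ → M) (hX : IsArcField X) (hE1 : CondE1 X) (hE2 : CondE2 X)
    (hlin : LinearSpeedGrowth X) :
    ∀ x : M, ∃ σ : ℝ → M, IsSolutionCurve X Set.univ σ x := by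
  intro x
  obtain ⟨σ, hσ0, hσ⟩ := exists_forward_curve hX hE1 hE2 hlin x
  obtain ⟨ν, hν0, hν⟩ := exists_forward_curve hX.neg hE1.neg hE2.neg hlin.neg x
  let γ : ℝ → M := fun t => if 0 ≤ t then σ t else ν (-t)
  have hpos : TangentOn X γ (Ici 0) := hσ.congr fun t ht => if_pos ht
  have hneg : TangentOn X γ (Iic 0) := by
    refine (hν.comp_neg.mono fun t (ht : t ≤ 0) => ?_).congr fun t (ht : t ≤ 0) => ?_
    · exact neg_nonneg.2 ht
    · rcases ht.eq_or_lt with rfl | hlt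
      · simp [γ, hσ0, hν0]
      · exact if_neg hlt.not_ge
  have hγ : TangentOn X γ univ := by
    rw [← Iic_union_Ici (a := (0 : ℝ))]
    exact hneg.union hpos isClosed_Iic isClosed_Ici
  refine ⟨γ, isOpen_univ, ordConnected_univ, mem_univ _, (if_pos le_rfl).trans hσ0,
    hγ.continuousOn hX, fun t _ => ?_⟩
  have h := hγ t (mem_univ t)
  rw [nhdsWithin_univ] at h
  have hk : Tendsto (fun h : ℝ => t + h) (𝓝 0) (𝓝 t) := by
    simpa using (continuous_const_add t).tendsto 0
  simpa [Function.comp_def] using h.comp_tendsto hk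
end

section
/- If arc fields X and Y on a metric space M close and both satisfy Conditions E1 and E2, then d(Y_{−t}(X_{−t}(Y_t(X_t(x)))), x) = O(t²) locally uniformly in x: for each x₀ ∈ M there exist positive constants C, r, δ such that d(Y_{−t}(X_{−t}(Y_t(X_t(x)))), x) ≤ Ct² for all x ∈ B(x₀,r) and |t| < δ. -/
open Metric Set Asymptotics

variable {M : Type*} [MetricSpace M]

open Filter Topology

/-- An arc field sends points near `x₀` to points near `x₀` for small times. -/
theorem IsArcField.tendsto_nhds {M : Type*} [MetricSpace M] {X : M → ℝ → M}
    (hX : IsArcField X) {α : Type*} {l : Filter α} {f : α → M} {u : α → ℝ} {x₀ : M}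
    (hf : Tendsto f l (𝓝 x₀)) (hu : Tendsto u l (𝓝 0)) :
    Tendsto (fun a => X (f a) (u a)) l (𝓝 x₀) := by
  obtain ⟨hc, h0, -⟩ := hX
  have hmem : (univ ×ˢ Icc (-1 : ℝ) 1 : Set (M × ℝ)) ∈ 𝓝 (x₀, (0 : ℝ)) :=
    prod_mem_nhds univ_mem (Icc_mem_nhds (by norm_num) (by norm_num))
  have hcont := (hc.continuousAt hmem).tendsto
  simp only [h0] at hcont
  exact hcont.comp (hf.prodMk_nhds hu)

theorem CondE2.dist_neg_le {M : Type*} [MetricSpace M] {X : M → ℝ → M} (hX : IsArcField X)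
    (hE2 : CondE2 X) (x₀ : M) :
    ∃ r > (0 : ℝ), ∃ δ > (0 : ℝ), ∃ Ω > (0 : ℝ), ∀ x ∈ ball x₀ r, ∀ t : ℝ, |t| < δ →
      dist (X (X x t) (-t)) x ≤ Ω * t ^ 2 := by
  obtain ⟨r, hr, δ, hδ, Ω, hΩ, h⟩ := hE2 x₀
  refine ⟨r, hr, δ, hδ, Ω, hΩ, fun x hx t ht => ?_⟩
  have := h x hx t (-t) ht (by rwa [abs_neg])
  rw [add_neg_cancel, hX.2.1, mul_neg, abs_neg, abs_mul_self, dist_comm] at this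
  linarith

/-- if `X` and `Y` close and satisfy E1 and E2, then
`d(Y₋ₜ X₋ₜ Yₜ Xₜ x, x) = O(t²)` locally uniformly in `x`. -/
theorem parallelogram_estimate
    {M : Type*} [MetricSpace M] (X Y : M → ℝ → M)
    (hX : IsArcField X) (hY : IsArcField Y) (hclose : Close X Y)
    (hXE1 : CondE1 X) (hXE2 : CondE2 X) (hYE1 : CondE1 Y) (hYE2 : CondE2 Y) :
    ∀ x₀ : M, ∃ C > (0 : ℝ), ∃ r > (0 : ℝ), ∃ δ > (0 : ℝ), ∀ x ∈ Metric.ball x₀ r,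
      ∀ t : ℝ, |t| < δ →
        dist (Y (X (Y (X x t) t) (-t)) (-t)) x ≤ C * t ^ 2 := by
  intro x₀
  obtain ⟨C, hC, r₀, hr₀, δ₀, hδ₀, hcl⟩ := hclose x₀
  obtain ⟨r₁, hr₁, δ₁, hδ₁, Λ₁, hΛ₁, hX1⟩ := hXE1 x₀
  obtain ⟨r₂, hr₂, δ₂, hδ₂, Λ₂, hΛ₂, hY1⟩ := hYE1 x₀
  obtain ⟨r₃, hr₃, δ₃, hδ₃, Ω₁, hΩ₁, hX2⟩ := hXE2.dist_neg_le hX x₀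
  obtain ⟨r₄, hr₄, δ₄, hδ₄, Ω₂, hΩ₂, hY2⟩ := hYE2.dist_neg_le hY x₀
  have hx : Tendsto (fun p : M × ℝ => p.1) (𝓝 (x₀, 0)) (𝓝 x₀) := continuous_fst.tendsto _
  have ht : Tendsto (fun p : M × ℝ => p.2) (𝓝 (x₀, 0)) (𝓝 0) := continuous_snd.tendsto _
  have hnt : Tendsto (fun p : M × ℝ => -p.2) (𝓝 (x₀, 0)) (𝓝 0) := by simpa using ht.neg
  have small : ∀ {d : ℝ}, 0 < d → ∀ᶠ p : M × ℝ in 𝓝 (x₀, 0), |p.2| < d := fun hd => by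
    simpa [Real.ball_eq_Ioo, abs_lt] using ht.eventually (ball_mem_nhds 0 hd)
  have hYx := hY.tendsto_nhds hx ht
  have hYX := hY.tendsto_nhds (hX.tendsto_nhds hx ht) ht
  have hXY := hX.tendsto_nhds hYx ht
  have hXYX := hX.tendsto_nhds hYX hnt
  have key : ∀ᶠ p : M × ℝ in 𝓝 (x₀, 0),
      dist (Y (X (Y (X p.1 p.2) p.2) (-p.2)) (-p.2)) p.1
        ≤ ((C * (1 + Λ₁) + Ω₁) * (1 + Λ₂) + Ω₂) * p.2 ^ 2 := by
    filter_upwards [small one_pos, small hδ₀, small hδ₁, small hδ₂, small hδ₃, small hδ₄,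
      hx (ball_mem_nhds x₀ hr₀), hx (ball_mem_nhds x₀ hr₄), hYX (ball_mem_nhds x₀ hr₁),
      hXY (ball_mem_nhds x₀ hr₁), hYx (ball_mem_nhds x₀ hr₃), hYx (ball_mem_nhds x₀ hr₂),
      hXYX (ball_mem_nhds x₀ hr₂)]
    rintro ⟨x, t⟩ t1 t₀ t₁ t₂ t₃ t₄ m₀ m₄ mYX mXY mY₃ mY₂ mXYX
    have hcomm : dist (Y (X x t) t) (X (Y x t) t) ≤ C * t ^ 2 := by
      simpa [abs_mul_self, sq] using hcl x m₀ t t t₀ t₀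
    have hXstep : dist (X (Y (X x t) t) (-t)) (Y x t) ≤ (C * (1 + Λ₁) + Ω₁) * t ^ 2 := by
      calc _ ≤ dist (X (Y (X x t) t) (-t)) (X (X (Y x t) t) (-t))
              + dist (X (X (Y x t) t) (-t)) (Y x t) := dist_triangle _ _ _
        _ ≤ dist (Y (X x t) t) (X (Y x t) t) * (1 + |-t| * Λ₁) + Ω₁ * t ^ 2 :=
            add_le_add (hX1 _ mYX _ mXY (-t) (by rwa [abs_neg])) (hX2 _ mY₃ t t₃)
        _ ≤ C * t ^ 2 * (1 + 1 * Λ₁) + Ω₁ * t ^ 2 := by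
            rw [abs_neg]
            have : |t| ≤ 1 := t1.le
            gcongr
        _ = _ := by ring
    calc _ ≤ dist (Y (X (Y (X x t) t) (-t)) (-t)) (Y (Y x t) (-t))
            + dist (Y (Y x t) (-t)) x := dist_triangle _ _ _
      _ ≤ dist (X (Y (X x t) t) (-t)) (Y x t) * (1 + |-t| * Λ₂) + Ω₂ * t ^ 2 :=
          add_le_add (hY1 _ mXYX _ mY₂ (-t) (by rwa [abs_neg])) (hY2 _ m₄ t t₄)
      _ ≤ (C * (1 + Λ₁) + Ω₁) * t ^ 2 * (1 + 1 * Λ₂) + Ω₂ * t ^ 2 := by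
          rw [abs_neg]
          have : |t| ≤ 1 := t1.le
          gcongr
      _ = _ := by ring
  obtain ⟨ε, hε, hball⟩ := Metric.eventually_nhds_iff_ball.1 key
  refine ⟨_, by positivity, ε, hε, ε, hε, fun x hx t ht => hball (x, t) ?_⟩
  rw [← ball_prod_same]
  exact ⟨hx, by simpa using ht⟩
end

section
/- If arc fields X and Y on a metric space M close and both satisfy Conditions E1 and E2, then their sum X+Y, defined by (X+Y)_t(x) := Y_t(X_t(x)), satisfies Conditions E1 and E2. -/
open Metric Set Asymptotics

variable {M : Type*} [MetricSpace M]

/-- An arc field moves points near `x₀` only slightly for short times. -/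
theorem IsArcField.exists_mem_ball {M : Type*} [MetricSpace M] {X : M → ℝ → M}
    (hX : IsArcField X) (x₀ : M) {ε : ℝ} (hε : 0 < ε) :
    ∃ η > (0 : ℝ), ∀ x ∈ ball x₀ η, ∀ t : ℝ, |t| < η → X x t ∈ ball x₀ ε := by
  have hcont : ContinuousAt (fun p : M × ℝ => X p.1 p.2) (x₀, 0) :=
    hX.1.continuousAt (prod_mem_nhds Filter.univ_mem (Icc_mem_nhds (by norm_num) (by norm_num)))
  obtain ⟨η, hη, h⟩ := Metric.continuousAt_iff.1 hcont ε hε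
  refine ⟨η, hη, fun x hx t ht => ?_⟩
  have hxt : dist (x, t) (x₀, (0 : ℝ)) < η := by
    rw [Prod.dist_eq]
    exact max_lt hx (by simpa using ht)
  simpa [hX.2.1] using h hxt

/-- A common radius on which two arc fields move points near `x₀` only slightly. -/
theorem IsArcField.exists_mem_ball_pair {M : Type*} [MetricSpace M] {X Y : M → ℝ → M}
    (hX : IsArcField X) (hY : IsArcField Y) (x₀ : M) {ε : ℝ} (hε : 0 < ε) :
    ∃ η > (0 : ℝ), η ≤ ε ∧
      ∀ x ∈ ball x₀ η, ∀ t : ℝ, |t| < η → X x t ∈ ball x₀ ε ∧ Y x t ∈ ball x₀ ε := by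
  obtain ⟨a, ha, hXa⟩ := hX.exists_mem_ball x₀ hε
  obtain ⟨b, hb, hYb⟩ := hY.exists_mem_ball x₀ hε
  refine ⟨min ε (min a b), by positivity, min_le_left _ _, fun x hx t ht => ?_⟩
  simp only [mem_ball, lt_min_iff] at hx ht
  exact ⟨hXa x hx.2.1 t ht.2.1, hYb x hx.2.2 t ht.2.2⟩

theorem CondE1.sumArc_of_arcField {M : Type*} [MetricSpace M] {X Y : M → ℝ → M} (hX : IsArcField X)
    (hXE1 : CondE1 X) (hYE1 : CondE1 Y) : CondE1 (sumArc X Y) := by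
  intro x₀
  obtain ⟨r, hr, δ, hδ, Λ, hΛ, hXΛ⟩ := hXE1 x₀
  obtain ⟨r', hr', δ', hδ', Λ', hΛ', hYΛ⟩ := hYE1 x₀
  obtain ⟨η, hη, hXη⟩ := hX.exists_mem_ball x₀ hr'
  refine ⟨min r η, by positivity, min (min δ δ') (min η 1), by positivity,
    Λ + Λ' + Λ * Λ', by positivity, fun x hx y hy t ht => ?_⟩
  simp only [mem_ball, lt_min_iff] at hx hy ht
  obtain ⟨⟨htδ, htδ'⟩, htη, ht1⟩ := ht
  have hfac : (1 + |t| * Λ) * (1 + |t| * Λ') ≤ 1 + |t| * (Λ + Λ' + Λ * Λ') := by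
    have := mul_le_mul_of_nonneg_right ht1.le (by positivity : 0 ≤ |t| * (Λ * Λ'))
    linarith
  calc dist (Y (X x t) t) (Y (X y t) t)
      ≤ dist (X x t) (X y t) * (1 + |t| * Λ') :=
        hYΛ _ (hXη x hx.2 t htη) _ (hXη y hy.2 t htη) t htδ'
    _ ≤ dist x y * (1 + |t| * Λ) * (1 + |t| * Λ') := by
        gcongr
        exact hXΛ x hx.1 y hy.1 t htδ
    _ ≤ dist x y * (1 + |t| * (Λ + Λ' + Λ * Λ')) := by
        rw [mul_assoc]
        gcongr

/-- Condition E1 bounds the Lipschitz constants of the maps `X_t` for short times by a single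
constant near each point. -/
theorem CondE1.exists_dist_le {M : Type*} [MetricSpace M] {X : M → ℝ → M} (hXE1 : CondE1 X)
    (x₀ : M) : ∃ r > (0 : ℝ), ∃ L > (0 : ℝ), ∀ x ∈ ball x₀ r, ∀ y ∈ ball x₀ r, ∀ t : ℝ,
      |t| < r → dist (X x t) (X y t) ≤ L * dist x y := by
  obtain ⟨r, hr, δ, hδ, Λ, hΛ, h⟩ := hXE1 x₀
  refine ⟨min r δ, by positivity, 1 + δ * Λ, by positivity, fun x hx y hy t ht => ?_⟩
  simp only [mem_ball, lt_min_iff] at hx hy ht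
  calc dist (X x t) (X y t) ≤ dist x y * (1 + |t| * Λ) := h x hx.1 y hy.1 t ht.2
    _ ≤ dist x y * (1 + δ * Λ) := by gcongr; exact ht.2.le
    _ = (1 + δ * Λ) * dist x y := mul_comm _ _

theorem CondE2.sumArc_of_close {M : Type*} [MetricSpace M] {X Y : M → ℝ → M} (hX : IsArcField X)
    (hY : IsArcField Y) (hclose : Close X Y) (hYE1 : CondE1 Y) (hXE2 : CondE2 X)
    (hYE2 : CondE2 Y) : CondE2 (sumArc X Y) := by
  intro x₀
  obtain ⟨r₁, hr₁, L, hL, hYL⟩ := hYE1.exists_dist_le x₀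
  obtain ⟨r₂, hr₂, δ₂, hδ₂, Ω, hΩ, hXΩ⟩ := hXE2 x₀
  obtain ⟨r₃, hr₃, δ₃, hδ₃, Ω', hΩ', hYΩ⟩ := hYE2 x₀
  obtain ⟨C, hC, r₄, hr₄, δ₄, hδ₄, hXY⟩ := hclose x₀
  obtain ⟨R, hR, hRle⟩ : ∃ R > (0 : ℝ), R ≤ r₁ ∧ (R ≤ r₂ ∧ R ≤ δ₂) ∧ (R ≤ r₃ ∧ R ≤ δ₃) ∧
      R ≤ r₄ ∧ R ≤ δ₄ :=
    ⟨min r₁ (min (min r₂ δ₂) (min (min r₃ δ₃) (min r₄ δ₄))), by positivity,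
      by simp only [← le_min_iff, le_refl]⟩
  obtain ⟨hR₁, ⟨hR₂, hRδ₂⟩, ⟨hR₃, hRδ₃⟩, hR₄, hRδ₄⟩ := hRle
  obtain ⟨a, ha, haR, hmemR⟩ := hX.exists_mem_ball_pair hY x₀ hR
  obtain ⟨b, hb, hba, hmema⟩ := hX.exists_mem_ball_pair hY x₀ ha
  obtain ⟨c, hc, hcb, hmemb⟩ := hX.exists_mem_ball_pair hY x₀ hb
  refine ⟨c, hc, c / 2, by positivity, L * Ω + Ω' + L * C, by positivity,
    fun x hx s t hs ht => ?_⟩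
  have hst : |s + t| < c := by linarith [abs_add_le s t]
  replace hs : |s| < c := by linarith
  replace ht : |t| < c := by linarith
  have hball : ∀ {u v : ℝ} {z : M}, u ≤ v → z ∈ ball x₀ u → z ∈ ball x₀ v :=
    fun h hz => ball_subset_ball h hz
  have hw : X x s ∈ ball x₀ b := (hmemb x hx s hs).1
  have hz : X (X x s) t ∈ ball x₀ a := (hmema _ hw t (by linarith)).1
  have hv : X x (s + t) ∈ ball x₀ b := (hmemb x hx _ hst).1
  have hYw : Y (X x s) s ∈ ball x₀ a := (hmema _ hw s (by linarith)).2
  have hYz : Y (X (X x s) t) s ∈ ball x₀ R := (hmemR _ hz s (by linarith)).2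
  have hXYw : X (Y (X x s) s) t ∈ ball x₀ R := (hmemR _ hYw t (by linarith)).1
  calc dist (Y (X x (s + t)) (s + t)) (Y (X (Y (X x s) s) t) t)
      ≤ dist (Y (X x (s + t)) (s + t)) (Y (X (X x s) t) (s + t)) +
        dist (Y (X (X x s) t) (s + t)) (Y (Y (X (X x s) t) s) t) +
        dist (Y (Y (X (X x s) t) s) t) (Y (X (Y (X x s) s) t) t) := dist_triangle4 _ _ _ _
    _ ≤ L * (|s * t| * Ω) + |s * t| * Ω' + L * (C * |s * t|) := by
        gcongr
        · refine (hYL _ (hball (by linarith) hv) _ (hball (by linarith) hz) _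
            (by linarith)).trans ?_
          gcongr
          exact hXΩ x (hball (by linarith) hx) s t (by linarith) (by linarith)
        · exact hYΩ _ (hball (by linarith) hz) s t (by linarith) (by linarith)
        · refine (hYL _ (hball (by linarith) hYz) _ (hball (by linarith) hXYw) _
            (by linarith)).trans ?_
          gcongr
          exact hXY _ (hball (by linarith) hw) s t (by linarith) (by linarith)
    _ = |s * t| * (L * Ω + Ω' + L * C) := by ring

/-- if `X` and `Y` close and satisfy E1 and E2, so does their sum
`(X+Y)_t x := Y_t (X_t x)`. -/
theorem sumArc_satisfies_E1_E2
    {M : Type*} [MetricSpace M] (X Y : M → ℝ → M)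
    (hX : IsArcField X) (hY : IsArcField Y) (hclose : Close X Y)
    (hXE1 : CondE1 X) (hXE2 : CondE2 X) (hYE1 : CondE1 Y) (hYE2 : CondE2 Y) :
    CondE1 (sumArc X Y) ∧ CondE2 (sumArc X Y) := by
  exact ⟨CondE1.sumArc_of_arcField hX hXE1 hYE1, CondE2.sumArc_of_close hX hY hclose hYE1 hXE2 hYE2⟩
end
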